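/- arXiv:2507.05242 — 7 statements merged into one kernel-verified Lean document; each statement's English description precedes it below -/
import Mathlib

section
/- Let A and B be n×n complex positive semidefinite matrices, fix s ∈ [0,1], and let g : ℝ → ℝ be a function on an interval J containing the spectrum of A such that the map x ↦ x^s · g(x) is nonnegative and monotone nonincreasing on J. Then Tr[g(A) · (A^{1/2} B A^{1/2})^s] ≤ Tr[g(A) · A^s · B^s]. -/
open scoped ComplexOrder

/-- `mpow A s` is the matrix power `A ^ s` (for real `s`) defined via the continuous
functional calculus: if `A = Σ_i λ_i P_i` is a spectral decomposition, `mpow A s = Σ_i λ_i ^ s • P_i`. -/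
noncomputable def mpow {m : ℕ} (A : Matrix (Fin m) (Fin m) ℂ) (s : ℝ) :
    Matrix (Fin m) (Fin m) ℂ :=
  cfc (fun x : ℝ => x ^ s) A

/-- `mfun f A` is `f(A)` defined via the continuous functional calculus:
if `A = Σ_i λ_i P_i` is a spectral decomposition, `mfun f A = Σ_i f (λ_i) • P_i`. -/
noncomputable def mfun {m : ℕ} (f : ℝ → ℝ) (A : Matrix (Fin m) (Fin m) ℂ) :
    Matrix (Fin m) (Fin m) ℂ :=
  cfc f A



namespace ALT
set_option linter.unusedSectionVars false
open Matrix

noncomputable def pw {ι : Type*} [Fintype ι] [DecidableEq ι] (A : Matrix ι ι ℂ) (s : ℝ) :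
    Matrix ι ι ℂ := cfc (fun x : ℝ => x ^ s) A

/-- real diagonal matrix -/
def dg {ι : Type*} [DecidableEq ι] (d : ι → ℝ) : Matrix ι ι ℂ := diagonal (fun i => (d i : ℂ))

section basic
variable {ι κ : Type*} [Fintype ι] [DecidableEq ι] [Fintype κ] [DecidableEq κ]

lemma dg_mul (d e : ι → ℝ) : dg d * dg e = dg (fun i => d i * e i) := by
  simp [dg]

lemma dg_one : dg (fun _ : ι => (1:ℝ)) = 1 := by
  simp [dg]

lemma dg_herm (d : ι → ℝ) : (dg d)ᴴ = dg d := by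
  simp [dg, diagonal_conjTranspose]

lemma dg_psd {d : ι → ℝ} (hd : ∀ i, 0 ≤ d i) : (dg d).PosSemidef := by
  rw [dg, posSemidef_diagonal_iff]
  intro i; exact_mod_cast hd i

lemma dg_pd {d : ι → ℝ} (hd : ∀ i, 0 < d i) : (dg d).PosDef := by
  rw [dg, posDef_diagonal_iff]
  intro i; exact_mod_cast hd i

lemma spec {M : Matrix ι ι ℂ} (hM : M.IsHermitian) :
    ∃ (U : Matrix ι ι ℂ) (d : ι → ℝ), Uᴴ * U = 1 ∧ U * Uᴴ = 1 ∧ M = U * dg d * Uᴴ ∧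
      (∀ f : ℝ → ℝ, cfc f M = U * dg (fun i => f (d i)) * Uᴴ) ∧
      (∀ i, d i ∈ spectrum ℝ M) ∧ (M.PosSemidef → ∀ i, 0 ≤ d i) ∧ (M.PosDef → ∀ i, 0 < d i) := by
  refine ⟨hM.eigenvectorUnitary, hM.eigenvalues, ?_, ?_, ?_, ?_, ?_, ?_, ?_⟩
  · exact (mem_unitaryGroup_iff'.1 hM.eigenvectorUnitary.2)
  · exact (mem_unitaryGroup_iff.1 hM.eigenvectorUnitary.2)
  · conv_lhs => rw [hM.spectral_theorem, Unitary.conjStarAlgAut_apply]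
    rfl
  · intro f
    rw [hM.cfc_eq, IsHermitian.cfc, Unitary.conjStarAlgAut_apply]
    rfl
  · intro i
    rw [hM.spectrum_real_eq_range_eigenvalues]
    exact ⟨i, rfl⟩
  · intro h i; exact h.eigenvalues_nonneg i
  · intro h i; exact h.eigenvalues_pos i

lemma cfc_inter {b : Matrix ι ι ℂ} (hb : b.IsHermitian) (T : Matrix ι κ ℂ) (d : κ → ℝ)
    (h : T * dg d = b * T) (f : ℝ → ℝ) :
    T * dg (fun i => f (d i)) = cfc f b * T := by
  obtain ⟨V, d0, h1, h2, h3, h4, -, hps, hpd⟩ := spec hb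
  rw [h4 f]
  have h5 : (Vᴴ * T) * dg d = dg d0 * (Vᴴ * T) := by
    rw [Matrix.mul_assoc, h, h3, ← Matrix.mul_assoc, ← Matrix.mul_assoc, ← Matrix.mul_assoc, h1,
      Matrix.one_mul, Matrix.mul_assoc]
  have h6 : (Vᴴ * T) * dg (fun i => f (d i)) = dg (fun i => f (d0 i)) * (Vᴴ * T) := by
    ext i j
    have := congrFun (congrFun h5 i) j
    simp only [dg, mul_diagonal, diagonal_mul] at this ⊢
    by_cases h0 : (Vᴴ * T) i j = 0
    · simp [h0]
    · rw [mul_comm, mul_left_inj' h0] at this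
      rw [mul_comm, Complex.ofReal_injective this]
  calc T * dg (fun i => f (d i)) = V * (Vᴴ * T * dg (fun i => f (d i))) := by
        rw [← Matrix.mul_assoc, ← Matrix.mul_assoc, h2, Matrix.one_mul]
    _ = _ := by rw [h6]; simp only [Matrix.mul_assoc]

lemma cfc_inter' {a b : Matrix ι ι ℂ} (ha : a.IsHermitian) (hb : b.IsHermitian) (T : Matrix ι ι ℂ)
    (h : T * a = b * T) (f : ℝ → ℝ) :
    T * cfc f a = cfc f b * T := by
  obtain ⟨V, d0, h1, h2, h3, h4, -, hps, hpd⟩ := spec ha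
  have := cfc_inter hb (T * V) d0 (by
    rw [← Matrix.mul_assoc, ← h, h3]
    simp only [Matrix.mul_assoc, h1, Matrix.mul_one]) f
  rw [h4 f, ← Matrix.mul_assoc, ← Matrix.mul_assoc, this]
  simp only [Matrix.mul_assoc, h2, Matrix.mul_one]

lemma dg_isH (d : ι → ℝ) : (dg d).IsHermitian := dg_herm d

lemma cfc_conj {U : Matrix ι ι ℂ} (h1 : Uᴴ * U = 1) (h2 : U * Uᴴ = 1) {M : Matrix ι ι ℂ}
    (hM : M.IsHermitian) (f : ℝ → ℝ) : cfc f (U * M * Uᴴ) = U * cfc f M * Uᴴ := by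
  have hb : (U * M * Uᴴ).IsHermitian := isHermitian_mul_mul_conjTranspose U hM
  rw [cfc_inter' hM hb U (by simp [Matrix.mul_assoc, h1]) f, Matrix.mul_assoc (cfc f _), h2, Matrix.mul_one]

lemma cfc_dg (d : ι → ℝ) (f : ℝ → ℝ) : cfc f (dg d) = dg (fun i => f (d i)) := by
  have := cfc_inter (dg_isH d) (1 : Matrix ι ι ℂ) d (by simp) f
  simpa using this.symm

lemma pw_dg (d : ι → ℝ) (s : ℝ) : pw (dg d) s = dg (fun i => d i ^ s) := cfc_dg d _

lemma pw_psd {M : Matrix ι ι ℂ} (hM : M.PosSemidef) (s : ℝ) : (pw M s).PosSemidef := by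
  obtain ⟨V, d0, h1, h2, h3, h4, -, hps, hpd⟩ := spec hM.1
  rw [pw, h4]
  exact (dg_psd fun i => Real.rpow_nonneg (hps hM i) s).mul_mul_conjTranspose_same V

lemma pw_pd {M : Matrix ι ι ℂ} (hM : M.PosDef) (s : ℝ) : (pw M s).PosDef := by
  obtain ⟨V, d0, h1, h2, h3, h4, -, hps, hpd⟩ := spec hM.1
  rw [pw, h4]
  refine (dg_pd fun i => Real.rpow_pos_of_pos (hpd hM i) s).mul_mul_conjTranspose_same ?_
  intro x y hxy
  have := congrArg (fun z => z ᵥ* Vᴴ) hxy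
  simpa [h2] using this

lemma pw_add {M : Matrix ι ι ℂ} (hM : M.PosDef) (s t : ℝ) : pw M s * pw M t = pw M (s + t) := by
  obtain ⟨V, d0, h1, h2, h3, h4, -, hps, hpd⟩ := spec hM.1
  rw [pw, pw, pw, h4, h4, h4]
  calc _ = V * (dg (fun i => d0 i ^ s) * ((Vᴴ * V) * dg (fun i => d0 i ^ t))) * Vᴴ := by
        simp only [Matrix.mul_assoc]
    _ = _ := by
      rw [h1, Matrix.one_mul, dg_mul]
      simp only [Real.rpow_add (hpd hM _)]

lemma pw_one {M : Matrix ι ι ℂ} (hM : M.IsHermitian) : pw M 1 = M := by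
  obtain ⟨V, d0, h1, h2, h3, h4, -, hps, hpd⟩ := spec hM
  rw [pw, h4]
  conv_rhs => rw [h3]
  simp

lemma pw_zero {M : Matrix ι ι ℂ} (hM : M.IsHermitian) : pw M 0 = 1 := by
  obtain ⟨V, d0, h1, h2, h3, h4, -, hps, hpd⟩ := spec hM
  rw [pw, h4]
  simp [dg_one, h2]

lemma pw_inv {M N : Matrix ι ι ℂ} (hM : M.PosDef) (hN : N.IsHermitian) (h : M * N = 1) (s : ℝ) :
    pw M s = pw N (-s) := by
  obtain ⟨V, d0, h1, h2, h3, h4, -, hps, hpd⟩ := spec hM.1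
  have h' : N * M = 1 := mul_eq_one_comm.1 h
  have key : N = V * dg (fun i => (d0 i)⁻¹) * Vᴴ := by
    have : M * (V * dg (fun i => (d0 i)⁻¹) * Vᴴ) = 1 := by
      conv_lhs => rw [h3]
      calc _ = V * (dg d0 * ((Vᴴ * V) * dg (fun i => (d0 i)⁻¹))) * Vᴴ := by
            simp only [Matrix.mul_assoc]
        _ = _ := by
          rw [h1, Matrix.one_mul, dg_mul]
          simp only [mul_inv_cancel₀ (hpd hM _).ne', dg_one, Matrix.mul_one, h2]
    calc N = N * (M * (V * dg (fun i => (d0 i)⁻¹) * Vᴴ)) := by rw [this, Matrix.mul_one]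
      _ = _ := by rw [← Matrix.mul_assoc, h', Matrix.one_mul]
  rw [pw, h4, pw, key, cfc_conj h1 h2 (dg_isH _), cfc_dg]
  congr; ext i
  rw [Real.rpow_neg (inv_nonneg.2 (hpd hM i).le), Real.inv_rpow (hpd hM i).le, inv_inv]

lemma pw_smul {M : Matrix ι ι ℂ} (hM : M.PosSemidef) {t : ℝ} (ht : 0 ≤ t) (s : ℝ) :
    pw ((t : ℂ) • M) s = ((t ^ s : ℝ) : ℂ) • pw M s := by
  obtain ⟨V, d0, h1, h2, h3, h4, -, hps, hpd⟩ := spec hM.1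
  have : (t : ℂ) • M = V * dg (fun i => t * d0 i) * Vᴴ := by
    conv_lhs => rw [h3]
    rw [← Matrix.smul_mul, ← Matrix.mul_smul]
    congr; ext i j; simp [dg, diagonal_apply]
  rw [this, pw, cfc_conj h1 h2 (dg_isH _), cfc_dg, pw, h4, ← Matrix.smul_mul, ← Matrix.mul_smul]
  congr; ext i j; simp [dg, diagonal_apply, Real.mul_rpow ht (hps hM _)]

end basic

section LH
open scoped MatrixOrder Matrix.Norms.L2Operator
variable {ι : Type*} [Fintype ι] [DecidableEq ι]

lemma LH {a b : Matrix ι ι ℂ} (ha : a.PosSemidef) (hab : (b - a).PosSemidef) {s : ℝ}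
    (hs : s ∈ Set.Icc (0:ℝ) 1) : (pw b s - pw a s).PosSemidef := by
  have h := CFC.rpow_le_rpow hs (show a ≤ b from hab)
  have h0 : 0 ≤ a := ha.nonneg
  have h1 : 0 ≤ b := h0.trans hab
  rw [CFC.rpow_eq_cfc_real h0, CFC.rpow_eq_cfc_real h1] at h
  exact h

lemma tend {s : ℝ} (hs : 0 ≤ s) {E F : Matrix ι ι ℂ} (hE : E.PosSemidef) (hF : F.PosSemidef) :
    Filter.Tendsto (fun e : ℝ => pw (E + (e:ℂ) • F) s) (nhdsWithin 0 (Set.Ioi 0))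
      (nhds (pw E s)) := by
  set a : ℝ → Matrix ι ι ℂ := fun e => E + (e:ℂ) • F
  have ha : Continuous a := by fun_prop
  have hpos : ∀ e : ℝ, 0 ≤ e → (a e).PosSemidef := fun e he =>
    hE.add (hF.smul (by exact_mod_cast he))
  have h0 : a 0 = E := by simp [a]
  have hc : ContinuousOn (fun e => cfc (fun x : ℝ => x ^ s) (a e)) (Set.Icc 0 1) := by
    refine ContinuousOn.cfc' (s := Set.Icc 0 (‖E‖ + ‖F‖)) isCompact_Icc _ ?_ ?_ ?_ ?_
    · exact ha.continuousOn
    · intro e he x hx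
      have h1 := spectrum_nonneg_of_nonneg (hpos e he.1).nonneg hx
      refine ⟨h1, ?_⟩
      have : ‖x‖ ≤ ‖a e‖ := by
        rcases isEmpty_or_nonempty ι with hi | hi
        · have hz : spectrum ℝ (a e) = ∅ := spectrum.of_subsingleton _
          rw [hz] at hx; exact hx.elim
        · exact spectrum.norm_le_norm_of_mem hx
      calc x ≤ ‖x‖ := le_abs_self x
        _ ≤ ‖a e‖ := this
        _ ≤ ‖E‖ + ‖(e:ℂ) • F‖ := norm_add_le _ _
        _ ≤ _ := by
          rw [norm_smul]
          have : ‖(e:ℂ)‖ ≤ 1 := by simp [abs_le]; constructor <;> linarith [he.1, he.2]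
          nlinarith [norm_nonneg F]
    · intro e he; exact (hpos e he.1).1
    · exact (Real.continuous_rpow_const hs).continuousOn
  have := (hc 0 (by simp)).tendsto.mono_left (nhdsWithin_mono 0 Set.Ioo_subset_Icc_self)
  rw [nhdsWithin_Ioo_eq_nhdsGT (by norm_num)] at this
  rw [h0] at this
  exact this
end LH
end ALT
namespace ALT
open Matrix Module
set_option linter.unusedSectionVars false

section cpd
variable {n : ℕ}

abbrev Ix (n k : ℕ) := ↥(Set.powersetCard (Fin n) k)

noncomputable instance (k : ℕ) : Fintype (Ix n k) := Fintype.ofFinite _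
noncomputable instance (k : ℕ) : DecidableEq (Ix n k) := Classical.decEq _

/-- increasing enumeration -/
noncomputable def en {k : ℕ} (S : Ix n k) : Fin k ↪o Fin n := Set.powersetCard.ofFinEmbEquiv.symm S

noncomputable def cpd (k : ℕ) (M : Matrix (Fin n) (Fin n) ℂ) : Matrix (Ix n k) (Ix n k) ℂ :=
  fun S T => (M.submatrix (en S) (en T)).det

lemma cpd_eq (k : ℕ) (M : Matrix (Fin n) (Fin n) ℂ) :
    cpd k M = LinearMap.toMatrix ((Pi.basisFun ℂ (Fin n)).exteriorPower k)
      ((Pi.basisFun ℂ (Fin n)).exteriorPower k) (exteriorPower.map k (toLin' M)) := by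
  ext S T
  rw [LinearMap.toMatrix_apply, exteriorPower.basis_repr_apply, exteriorPower.basis_apply,
    exteriorPower.ιMulti_family, exteriorPower.map_apply_ιMulti,
    exteriorPower.ιMultiDual_apply_ιMulti, cpd, ← det_transpose]
  congr 1
  ext i j
  simp [en]

lemma cpd_mul (k : ℕ) (M N : Matrix (Fin n) (Fin n) ℂ) : cpd k (M * N) = cpd k M * cpd k N := by
  rw [cpd_eq, cpd_eq, cpd_eq, toLin'_mul, exteriorPower.map_comp, LinearMap.toMatrix_comp _ ((Pi.basisFun ℂ (Fin n)).exteriorPower k)]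

lemma cpd_one (k : ℕ) : cpd k (1 : Matrix (Fin n) (Fin n) ℂ) = 1 := by
  rw [cpd_eq, toLin'_one, exteriorPower.map_id, LinearMap.toMatrix_id]

lemma cpd_ct (k : ℕ) (M : Matrix (Fin n) (Fin n) ℂ) : cpd k Mᴴ = (cpd k M)ᴴ := by
  ext S T
  rw [conjTranspose_apply, cpd, cpd, ← det_conjTranspose]
  rfl

lemma cpd_dg (k : ℕ) (d : Fin n → ℝ) : cpd k (dg d) = dg (fun S => ∏ i, d (en S i)) := by
  ext S T
  by_cases h : S = T
  · subst h
    have : (dg d).submatrix (en S) (en S) = diagonal (fun i => (d (en S i) : ℂ)) := by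
      ext i j; simp [dg, diagonal_apply]
    rw [cpd, this, det_diagonal]; simp [dg]
  · have h2 : dg (fun S : Ix n k => ∏ i, d (en S i)) S T = 0 := by simp [dg, h]
    rw [h2, cpd]
    obtain ⟨i, his, hit⟩ := (Set.powersetCard.exists_mem_notMem_iff_ne S T).mp h
    obtain ⟨l, rfl⟩ := (Set.powersetCard.mem_range_ofFinEmbEquiv_symm_iff_mem S i).mpr his
    apply Matrix.det_eq_zero_of_row_eq_zero l
    intro j
    simp only [submatrix_apply, dg]
    apply diagonal_apply_ne
    intro h3
    apply hit
    rw [← Set.powersetCard.mem_range_ofFinEmbEquiv_symm_iff_mem T]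
    exact ⟨j, h3.symm⟩

lemma cpd_herm (k : ℕ) {M : Matrix (Fin n) (Fin n) ℂ} (hM : M.IsHermitian) : (cpd k M).IsHermitian := by
  rw [IsHermitian, ← cpd_ct, hM.eq]

lemma cpd_psd (k : ℕ) {M : Matrix (Fin n) (Fin n) ℂ} (hM : M.PosSemidef) : (cpd k M).PosSemidef := by
  obtain ⟨V, d0, h1, h2, h3, h4, -, hps, hpd⟩ := spec hM.1
  rw [h3, cpd_mul, cpd_mul, cpd_ct, cpd_dg]
  exact (dg_psd fun S => Finset.prod_nonneg fun i _ => hps hM _).mul_mul_conjTranspose_same _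

lemma cpd_pw (k : ℕ) {M : Matrix (Fin n) (Fin n) ℂ} (hM : M.PosSemidef) (s : ℝ) :
    cpd k (pw M s) = pw (cpd k M) s := by
  obtain ⟨V, d0, h1, h2, h3, h4, -, hps, hpd⟩ := spec hM.1
  have u1 : (cpd k V)ᴴ * cpd k V = 1 := by rw [← cpd_ct, ← cpd_mul, h1, cpd_one]
  have u2 : cpd k V * (cpd k V)ᴴ = 1 := by rw [← cpd_ct, ← cpd_mul, h2, cpd_one]
  have h5 : pw (cpd k M) s = cpd k V * dg (fun S => (∏ i, d0 (en S i)) ^ s) * (cpd k V)ᴴ := by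
    rw [h3, cpd_mul, cpd_mul, cpd_ct, cpd_dg, pw, cfc_conj u1 u2 (dg_isH _), cfc_dg]
  rw [h5, pw, h4, cpd_mul, cpd_mul, cpd_ct, cpd_dg]
  congr; ext S
  rw [Real.finsetProd_rpow _ _ (fun i _ => hps hM _)]

end cpd

lemma LZ {ι : Type*} [Fintype ι] [DecidableEq ι] {α : ι → ℝ} (hα : ∀ i, 0 < α i) {B : Matrix ι ι ℂ}
    (hB : B.PosSemidef) {b : ℝ} (hb : 0 ≤ b) (h : (dg (fun _ => b) - B).PosSemidef) {s : ℝ}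
    (hs : s ∈ Set.Icc (0:ℝ) 1) :
    (dg (fun _ => b ^ s) - dg (fun i => α i ^ (-s/2)) *
      pw (dg (fun i => α i ^ (1/2 : ℝ)) * B * dg (fun i => α i ^ (1/2 : ℝ))) s *
      dg (fun i => α i ^ (-s/2))).PosSemidef := by
  have h1 : (dg (fun i => α i ^ (1/2 : ℝ)) * B * dg (fun i => α i ^ (1/2 : ℝ))).PosSemidef := by
    have := hB.mul_mul_conjTranspose_same (dg (fun i => α i ^ (1/2 : ℝ)))
    rwa [dg_herm] at this
  have h2 : (dg (fun i => b * α i) - dg (fun i => α i ^ (1/2 : ℝ)) * B * dg (fun i => α i ^ (1/2 : ℝ))).PosSemidef := by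
    have := h.mul_mul_conjTranspose_same (dg (fun i => α i ^ (1/2 : ℝ)))
    rw [dg_herm, Matrix.mul_sub, Matrix.sub_mul, dg_mul, dg_mul] at this
    convert this using 4 with i
    have : α i ^ (1/2:ℝ) * α i ^ (1/2:ℝ) = α i := by rw [← Real.rpow_add (hα i)]; norm_num
    rw [mul_right_comm, this, mul_comm]
  have h3 := (LH h1 h2 hs).mul_mul_conjTranspose_same (dg (fun i => α i ^ (-s/2)))
  rw [pw_dg, dg_herm, Matrix.mul_sub, Matrix.sub_mul, dg_mul, dg_mul] at h3
  convert h3 using 4 with i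
  rw [Real.mul_rpow hb (hα i).le]
  have : α i ^ (-s/2) * α i ^ s * α i ^ (-s/2) = 1 := by
    rw [← Real.rpow_add (hα i), ← Real.rpow_add (hα i)]; ring_nf; simp
  linear_combination (-b ^ s) * this

lemma abel {n : ℕ} (w D : Fin n → ℝ) (hw : Antitone w) (hw0 : ∀ i, 0 ≤ w i)
    (hD : ∀ k : ℕ, k ≤ n → 0 ≤ ∑ i with i.val < k, D i) : 0 ≤ ∑ i, w i * D i := by
  induction n with
  | zero => simp
  | succ n ih =>
    have e1 : ∀ k ≤ n, ∑ i with i.val < k, D i = ∑ i : Fin n with i.val < k, D i.castSucc := by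
      intro k hk
      rw [Finset.sum_filter, Finset.sum_filter, Fin.sum_univ_castSucc]
      simp [hk]
    have e2 : 0 ≤ ∑ i, D i := by
      have := hD (n+1) le_rfl
      rwa [Finset.filter_true_of_mem (fun i _ => i.2)] at this
    have := ih (fun i => w i.castSucc - w (Fin.last n)) (fun i => D i.castSucc)
      (fun i j h => sub_le_sub_right (hw (Fin.castSucc_le_castSucc_iff.2 h)) _)
      (fun i => sub_nonneg.2 (hw (Fin.le_last _)))
      (fun k hk => by rw [← e1 k hk]; exact hD k (by omega))
    have e3 := mul_nonneg (hw0 (Fin.last n)) e2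
    rw [Fin.sum_univ_castSucc] at e3 ⊢
    simp only [sub_mul, Finset.sum_sub_distrib, ← Finset.mul_sum] at this
    linarith

/-- log majorization implies the sum inequality -/
lemma major {n : ℕ} (x y : Fin n → ℝ) (hx : Antitone x) (hx0 : ∀ i, 0 < x i) (hy0 : ∀ i, 0 < y i)
    (h : ∀ k : ℕ, k ≤ n → ∏ i with i.val < k, x i ≤ ∏ i with i.val < k, y i) :
    ∑ i, x i ≤ ∑ i, y i := by
  have := abel x (fun i => Real.log (y i) - Real.log (x i)) hx (fun i => (hx0 i).le) (by
    intro k hk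
    rw [Finset.sum_sub_distrib, ← Real.log_prod (fun i _ => (hy0 i).ne'),
      ← Real.log_prod (fun i _ => (hx0 i).ne'), sub_nonneg]
    exact Real.log_le_log (Finset.prod_pos fun i _ => hx0 i) (h k hk))
  have h2 : ∀ i, x i * (Real.log (y i) - Real.log (x i)) ≤ y i - x i := by
    intro i
    rw [← Real.log_div (hy0 i).ne' (hx0 i).ne']
    have := Real.log_le_sub_one_of_pos (div_pos (hy0 i) (hx0 i))
    calc _ ≤ x i * (y i / x i - 1) := mul_le_mul_of_nonneg_left this (hx0 i).le
      _ = _ := by field_simp [(hx0 i).ne']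
  have h3 := Finset.sum_le_sum (fun i (_ : i ∈ Finset.univ) => h2 i)
  rw [Finset.sum_sub_distrib] at h3
  linarith

/-- sorted spectral decomposition -/
lemma spec_mono {n : ℕ} {M : Matrix (Fin n) (Fin n) ℂ} (hM : M.IsHermitian) :
    ∃ (U : Matrix (Fin n) (Fin n) ℂ) (d : Fin n → ℝ), Uᴴ * U = 1 ∧ U * Uᴴ = 1 ∧ M = U * dg d * Uᴴ ∧
      Monotone d ∧
      (∀ i, d i ∈ spectrum ℝ M) ∧ (M.PosSemidef → ∀ i, 0 ≤ d i) ∧ (M.PosDef → ∀ i, 0 < d i) := by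
  obtain ⟨V, d0, h1, h2, h3, h4, h5, hps, hpd⟩ := spec hM
  set σ := Tuple.sort d0
  refine ⟨V.submatrix id σ, d0 ∘ σ, ?_, ?_, ?_, Tuple.monotone_sort d0, fun i => h5 _,
    fun h i => hps h _, fun h i => hpd h _⟩
  · rw [conjTranspose_submatrix, ← submatrix_mul _ _ _ _ _ Function.bijective_id, h1]
    simp
  · rw [conjTranspose_submatrix, ← submatrix_mul _ _ _ _ _ σ.bijective, h2]
    simp
  · have : dg (d0 ∘ σ) = (dg d0).submatrix σ σ := by
      ext i j; simp [dg, diagonal_apply]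
    rw [this, conjTranspose_submatrix, ← submatrix_mul _ _ _ _ _ σ.bijective, ← submatrix_mul _ _ _ _ _ σ.bijective, ← h3]
    simp

lemma spec_anti {n : ℕ} {M : Matrix (Fin n) (Fin n) ℂ} (hM : M.IsHermitian) :
    ∃ (U : Matrix (Fin n) (Fin n) ℂ) (d : Fin n → ℝ), Uᴴ * U = 1 ∧ U * Uᴴ = 1 ∧ M = U * dg d * Uᴴ ∧
      Antitone d ∧
      (M.PosSemidef → ∀ i, 0 ≤ d i) ∧ (M.PosDef → ∀ i, 0 < d i) := by
  obtain ⟨V, d0, h1, h2, h3, h4, h5, hps, hpd⟩ := spec_mono hM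
  set σ : Equiv.Perm (Fin n) := Fin.revPerm
  refine ⟨V.submatrix id σ, d0 ∘ σ, ?_, ?_, ?_, ?_,
    fun h i => hps h _, fun h i => hpd h _⟩
  · rw [conjTranspose_submatrix, ← submatrix_mul _ _ _ _ _ Function.bijective_id, h1]
    simp
  · rw [conjTranspose_submatrix, ← submatrix_mul _ _ _ _ _ σ.bijective, h2]
    simp
  · have : dg (d0 ∘ σ) = (dg d0).submatrix σ σ := by
      ext i j; simp [dg, diagonal_apply]
    rw [this, conjTranspose_submatrix, ← submatrix_mul _ _ _ _ _ σ.bijective, ← submatrix_mul _ _ _ _ _ σ.bijective, ← h3]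
    simp
  · intro i j h
    exact h4 (by simpa [σ] using h)
end ALT
namespace ALT
open Matrix Module
set_option linter.unusedSectionVars false

section main
variable {ι : Type*} [Fintype ι] [DecidableEq ι]

lemma pd_conj {M : Matrix ι ι ℂ} (hM : M.PosDef) {T S : Matrix ι ι ℂ} (h : T * S = 1) :
    (T * M * Tᴴ).PosDef := by
  refine hM.mul_mul_conjTranspose_same ?_
  intro x y hxy
  have := congrArg (fun z => z ᵥ* S) hxy
  simpa [h] using this

lemma trace_conj {U M : Matrix ι ι ℂ} (h1 : Uᴴ * U = 1) : trace (U * M * Uᴴ) = trace M := by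
  rw [trace_mul_comm, ← Matrix.mul_assoc, h1, Matrix.one_mul]

/-- `A^{1/2} B A^{1/2}` for diagonal `A` -/
noncomputable def E (a : ι → ℝ) (B : Matrix ι ι ℂ) : Matrix ι ι ℂ :=
  dg (fun i => a i ^ (1/2 : ℝ)) * B * dg (fun i => a i ^ (1/2 : ℝ))

lemma E_psd (a : ι → ℝ) {B : Matrix ι ι ℂ} (hB : B.PosSemidef) : (E a B).PosSemidef := by
  have := hB.mul_mul_conjTranspose_same (dg (fun i => a i ^ (1/2 : ℝ)))
  rwa [dg_herm] at this

lemma dg_inv {a : ι → ℝ} (ha : ∀ i, 0 < a i) (r : ℝ) :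
    dg (fun i => a i ^ r) * dg (fun i => a i ^ (-r)) = 1 := by
  rw [dg_mul, ← dg_one]
  congr; ext i
  rw [← Real.rpow_add (ha i)]; simp

lemma dg_half {a : ι → ℝ} (ha : ∀ i, 0 ≤ a i) :
    dg (fun i => a i ^ (1/2:ℝ)) * dg (fun i => a i ^ (1/2:ℝ)) = dg a := by
  rw [dg_mul]
  congr; ext i
  rw [← Real.sqrt_eq_rpow, Real.mul_self_sqrt (ha i)]

lemma E_pd {a : ι → ℝ} (ha : ∀ i, 0 < a i) {B : Matrix ι ι ℂ} (hB : B.PosDef) : (E a B).PosDef := by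
  have := pd_conj hB (dg_inv ha (1/2))
  rwa [dg_herm] at this

lemma pw_sa {M : Matrix ι ι ℂ} (hM : M.PosSemidef) (r : ℝ) : (pw M r)ᴴ = pw M r := (pw_psd hM r).1

lemma F_eq {a : ι → ℝ} (ha : ∀ i, 0 < a i) {B : Matrix ι ι ℂ} (hB : B.PosDef) (s : ℝ) :
    dg (fun i => a i ^ (-(1/2) : ℝ)) * pw (E a B) s * dg (fun i => a i ^ (-(1/2) : ℝ)) =
    pw B (1/2) * pw (pw B (-(1/2)) * dg (fun i => (a i)⁻¹) * pw B (-(1/2))) (1 - s) * pw B (1/2) := by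
  set C := pw B (1/2) with hC
  set C' := pw B (-(1/2)) with hC'
  have cc : C * C' = 1 := by rw [hC, hC', pw_add hB]; simp [pw_zero hB.1]
  have cc2 : C' * C = 1 := mul_eq_one_comm.1 cc
  have cB : C * C = B := by rw [hC, pw_add hB]; norm_num; exact pw_one hB.1
  have ch : Cᴴ = C := pw_sa hB.posSemidef _
  have ch' : C'ᴴ = C' := pw_sa hB.posSemidef _
  set d := dg (fun i => a i ^ (1/2:ℝ)) with hd
  set d' := dg (fun i => a i ^ (-(1/2):ℝ)) with hd'
  have dd : d * d' = 1 := dg_inv ha (1/2)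
  have dd2 : d' * d = 1 := mul_eq_one_comm.1 dd
  have d2 : d * d = dg a := dg_half (fun i => (ha i).le)
  have hE : E a B = d * C * (C * d) := by rw [E, ← cB]; simp only [Matrix.mul_assoc]; rfl
  have hNpd : (C * dg a * C).PosDef := by
    have := pd_conj (dg_pd ha) cc
    rwa [ch] at this
  have hN : C * dg a * C = (C * d) * (d * C) := by rw [← d2]; simp only [Matrix.mul_assoc]
  have hEpd := E_pd ha hB
  have h1 : (d * C) * pw (C * dg a * C) (s - 1) = pw (E a B) (s - 1) * (d * C) := by
    apply cfc_inter' hNpd.1 hEpd.1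
    rw [hE, hN]; simp only [Matrix.mul_assoc]
  have h2 : pw (E a B) s = (d * C) * pw (C * dg a * C) (s - 1) * (C * d) := by
    rw [h1, Matrix.mul_assoc, ← hE]
    have := pw_add hEpd (s - 1) 1
    rw [pw_one hEpd.1] at this
    rw [this]; ring_nf
  have hK : (C * dg a * C) * (C' * dg (fun i => (a i)⁻¹) * C') = 1 := by
    calc _ = C * (dg a * ((C * C') * dg (fun i => (a i)⁻¹))) * C' := by simp only [Matrix.mul_assoc]
      _ = 1 := by
        rw [cc, Matrix.one_mul, dg_mul]
        simp only [mul_inv_cancel₀ (ha _).ne', dg_one, Matrix.mul_one, cc]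
  have hKh : (C' * dg (fun i => (a i)⁻¹) * C').IsHermitian := by
    have := isHermitian_mul_mul_conjTranspose C' (dg_isH (fun i => (a i)⁻¹))
    rwa [ch'] at this
  have h3 := pw_inv hNpd hKh hK (s - 1)
  rw [neg_sub] at h3
  rw [h2, h3]
  calc _ = (d' * d) * (C * pw (C' * dg (fun i => (a i)⁻¹) * C') (1 - s) * C) * (d * d') := by
        simp only [Matrix.mul_assoc]
    _ = _ := by rw [dd, dd2, Matrix.one_mul, Matrix.mul_one]

lemma F_anti {a a' : ι → ℝ} (ha : ∀ i, 0 < a i) (haa : ∀ i, a i ≤ a' i) {B : Matrix ι ι ℂ}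
    (hB : B.PosDef) {s : ℝ} (hs : s ∈ Set.Icc (0:ℝ) 1) (i : ι) :
    (a' i)⁻¹ * (pw (E a' B) s i i).re ≤ (a i)⁻¹ * (pw (E a B) s i i).re := by
  have ha' : ∀ i, 0 < a' i := fun i => (ha i).trans_le (haa i)
  have ch : (pw B (1/2))ᴴ = pw B (1/2) := pw_sa hB.posSemidef _
  have ch' : (pw B (-(1/2)))ᴴ = pw B (-(1/2)) := pw_sa hB.posSemidef _
  have k1 : (pw B (-(1/2)) * dg (fun i => (a' i)⁻¹) * pw B (-(1/2))).PosSemidef := by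
    have := (dg_psd (fun i => (inv_pos.2 (ha' i)).le)).mul_mul_conjTranspose_same (pw B (-(1/2)))
    rwa [ch'] at this
  have k2 : (pw B (-(1/2)) * dg (fun i => (a i)⁻¹) * pw B (-(1/2)) -
      pw B (-(1/2)) * dg (fun i => (a' i)⁻¹) * pw B (-(1/2))).PosSemidef := by
    have := (dg_psd (fun i => sub_nonneg.2 (inv_anti₀ (ha i) (haa i)))).mul_mul_conjTranspose_same
      (pw B (-(1/2)))
    rw [ch'] at this
    rw [← Matrix.sub_mul, ← Matrix.mul_sub]
    convert this using 3
    ext i j; simp only [dg, Matrix.sub_apply, diagonal_apply]; split_ifs <;> simp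
  have k3 := LH k1 k2 (s := 1 - s) ⟨by linarith [hs.2], by linarith [hs.1]⟩
  have k4 := k3.mul_mul_conjTranspose_same (pw B (1/2))
  rw [ch, Matrix.mul_sub, Matrix.sub_mul, ← F_eq ha hB, ← F_eq ha' hB] at k4
  have k5 := k4.diag_nonneg (i := i)
  have e : ∀ a : ι → ℝ, (∀ i, 0 < a i) → (dg (fun i => a i ^ (-(1/2) : ℝ)) * pw (E a B) s *
      dg (fun i => a i ^ (-(1/2) : ℝ))) i i = ((a i)⁻¹ : ℝ) * pw (E a B) s i i := by
    intro a ha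
    rw [dg, mul_diagonal, diagonal_mul]
    have : a i ^ (-(1/2) : ℝ) * a i ^ (-(1/2) : ℝ) = (a i)⁻¹ := by
      rw [← Real.rpow_add (ha i), ← Real.rpow_neg_one]; norm_num
    rw [← this]; push_cast; ring
  rw [Matrix.sub_apply, e a ha, e a' ha'] at k5
  have := (Complex.le_def.1 k5).1
  rw [Complex.sub_re, Complex.re_ofReal_mul, Complex.re_ofReal_mul] at this
  simpa using this

end main

section T
variable {n : ℕ}

lemma prod_lt {k : ℕ} (hk : k ≤ n) (x : Fin n → ℝ) :
    ∏ i with i.val < k, x i = ∏ i : Fin k, x (Fin.castLE hk i) := by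
  symm
  refine Finset.prod_bij (fun i _ => Fin.castLE hk i) ?_ ?_ ?_ ?_
  · intro i _; simp
  · intro i _ j _ h; simpa using h
  · intro i hi; exact ⟨⟨i, by simpa using hi⟩, by simp, rfl⟩
  · intro i _; rfl

lemma le_emb {k : ℕ} (hk : k ≤ n) (f : Fin k ↪o Fin n) (i : Fin k) : Fin.castLE hk i ≤ f i := by
  rw [Fin.le_def]
  simp only [Fin.val_castLE]
  obtain ⟨i, hi⟩ := i
  induction i with
  | zero => simp
  | succ j ih =>
    have h1 := ih (by omega)
    have : f ⟨j, by omega⟩ < f ⟨j+1, hi⟩ := f.strictMono (by simp [Fin.lt_def])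
    rw [Fin.lt_def] at this
    simp only at h1 ⊢
    omega

lemma T_ineq {a : Fin n → ℝ} (ha : ∀ i, 0 < a i) {B : Matrix (Fin n) (Fin n) ℂ}
    (hB : B.PosDef) {s : ℝ} (hs : s ∈ Set.Icc (0:ℝ) 1) :
    ∑ i, a i ^ (-s) * (pw (E a B) s i i).re ≤ ∑ i, (pw B s i i).re := by
  set Z := dg (fun i => a i ^ (-s/2)) * pw (E a B) s * dg (fun i => a i ^ (-s/2)) with hZ
  have hZpd : Z.PosDef := by
    have h := dg_inv ha (-s/2)
    have := pd_conj (pw_pd (E_pd ha hB) s) h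
    rwa [dg_herm] at this
  have eL : ∑ i, a i ^ (-s) * (pw (E a B) s i i).re = (trace Z).re := by
    rw [trace, Complex.re_sum]
    refine Finset.sum_congr rfl fun i _ => ?_
    rw [diag_apply, hZ, dg, mul_diagonal, diagonal_mul, mul_assoc, mul_comm (pw _ _ _ _), ← mul_assoc,
      ← Complex.ofReal_mul, ← Real.rpow_add (ha i), Complex.re_ofReal_mul]
    ring_nf
  have eR : ∑ i, (pw B s i i).re = (trace (pw B s)).re := by
    rw [trace, Complex.re_sum]; rfl
  obtain ⟨U, z, u1, u2, u3, uz, -, zpos⟩ := spec_anti hZpd.1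
  obtain ⟨V, β, v1, v2, v3, vβ, -, βpos⟩ := spec_anti hB.1
  replace zpos := zpos hZpd
  replace βpos := βpos hB
  have hBs : pw B s = V * dg (fun i => β i ^ s) * Vᴴ := by
    rw [v3, pw, cfc_conj v1 v2 (dg_isH _), cfc_dg]
  have tr : ∀ d : Fin n → ℝ, (trace (dg d)).re = ∑ i, d i := by
    intro d; simp [dg, trace_diagonal]
  rw [eL, eR, hBs, u3, trace_conj u1, trace_conj v1, tr, tr]
  refine major z _ uz zpos (fun i => Real.rpow_pos_of_pos (βpos i) s) ?_
  intro k hk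
  rw [prod_lt hk, prod_lt hk, Real.finsetProd_rpow _ _ (fun i _ => (βpos _).le)]
  set b := ∏ i : Fin k, β (Fin.castLE hk i) with hb
  have hb0 : 0 ≤ b := Finset.prod_nonneg fun i _ => (βpos _).le
  set α : Ix n k → ℝ := fun S => ∏ i, a (en S i) with hα
  have hα0 : ∀ S, 0 < α S := fun S => Finset.prod_pos fun i _ => ha _
  have cp : ∀ r : ℝ, cpd k (dg (fun i => a i ^ r)) = dg (fun S => α S ^ r) := by
    intro r
    rw [cpd_dg]; congr; ext S
    rw [Real.finsetProd_rpow _ _ (fun i _ => (ha _).le)]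
  have hZk : cpd k Z = dg (fun S => α S ^ (-s/2)) *
      pw (dg (fun S => α S ^ (1/2 : ℝ)) * cpd k B * dg (fun S => α S ^ (1/2 : ℝ))) s *
      dg (fun S => α S ^ (-s/2)) := by
    rw [hZ, cpd_mul, cpd_mul, cp, cpd_pw k (E_pd ha hB).posSemidef, E, cpd_mul, cpd_mul, cp]
  have uni : ∀ W : Matrix (Fin n) (Fin n) ℂ, W * Wᴴ = 1 → cpd k W * (cpd k W)ᴴ = 1 := by
    intro W h; rw [← cpd_ct, ← cpd_mul, h, cpd_one]
  have uni' : ∀ W : Matrix (Fin n) (Fin n) ℂ, Wᴴ * W = 1 → (cpd k W)ᴴ * cpd k W = 1 := by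
    intro W h; rw [← cpd_ct, ← cpd_mul, h, cpd_one]
  have cst : ∀ c : ℝ, dg (fun _ : Ix n k => c) = (c : ℂ) • 1 := by
    intro c; ext i j; simp [dg, diagonal_apply, one_apply]
  have dsub : ∀ d e : Ix n k → ℝ, dg d - dg e = dg (fun S => d S - e S) := by
    intro d e; ext i j; simp only [dg, Matrix.sub_apply, diagonal_apply]; split_ifs <;> simp
  have hBk : (dg (fun _ : Ix n k => b) - cpd k B).PosSemidef := by
    have h1 : (dg (fun S : Ix n k => b - ∏ i, β (en S i))).PosSemidef := by
      refine dg_psd fun S => sub_nonneg.2 ?_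
      exact Finset.prod_le_prod (fun i _ => (βpos _).le) (fun i _ => vβ (le_emb hk _ i))
    have := h1.mul_mul_conjTranspose_same (cpd k V)
    rw [← dsub, Matrix.mul_sub, Matrix.sub_mul, cst, Matrix.mul_smul, Matrix.mul_one,
      Matrix.smul_mul, uni V v2, ← cpd_dg, ← cpd_ct, ← cpd_mul, ← cpd_mul, ← v3, ← cst] at this
    exact this
  have key := LZ hα0 (cpd_psd k hB.posSemidef) hb0 hBk hs
  rw [← hZk] at key
  have key2 := key.conjTranspose_mul_mul_same (cpd k U)
  rw [Matrix.mul_sub, Matrix.sub_mul, cst, Matrix.mul_smul, Matrix.mul_one,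
      Matrix.smul_mul, uni' U u1, ← cst, u3, cpd_mul, cpd_mul, cpd_ct] at key2
  have e3 : (cpd k U)ᴴ * (cpd k U * cpd k (dg z) * (cpd k U)ᴴ) * cpd k U = cpd k (dg z) := by
    calc _ = ((cpd k U)ᴴ * cpd k U) * cpd k (dg z) * ((cpd k U)ᴴ * cpd k U) := by
          simp only [Matrix.mul_assoc]
      _ = _ := by rw [uni' U u1, Matrix.one_mul, Matrix.mul_one]
  rw [e3, cpd_dg, dsub] at key2
  have h4 := key2.diag_nonneg (i := Set.powersetCard.ofFinEmbEquiv (Fin.castLEOrderEmb hk))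
  simp only [dg, diagonal_apply_eq, en, Equiv.symm_apply_apply] at h4
  have h5 : (0:ℝ) ≤ b ^ s - ∏ i, z (Fin.castLEOrderEmb hk i) := by exact_mod_cast h4
  exact sub_nonneg.1 h5

lemma partial_ineq {a : Fin n → ℝ} (ha : ∀ i, 0 < a i) (hm : Monotone a)
    {B : Matrix (Fin n) (Fin n) ℂ}
    (hB : B.PosDef) {s : ℝ} (hs : s ∈ Set.Icc (0:ℝ) 1) (k : ℕ) (hk : k ≤ n) :
    0 ≤ ∑ i with i.val < k, ((pw B s i i).re - a i ^ (-s) * (pw (E a B) s i i).re) := by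
  rcases k with _ | k
  · simp
  set t := a ⟨k, hk⟩ with ht
  have ht0 : 0 < t := ha _
  set a' : Fin n → ℝ := fun i => min (a i) t with ha'
  have ha'0 : ∀ i, 0 < a' i := fun i => lt_min (ha i) ht0
  have h1 : ∀ i : Fin n, i.val < k + 1 → a' i = a i := by
    intro i hi
    exact min_eq_left (hm (by rw [Fin.le_def]; simp only; omega))
  have h2 : ∀ i : Fin n, ¬ i.val < k + 1 → a' i = t := by
    intro i hi
    exact min_eq_right (hm (by rw [Fin.le_def]; simp only; omega))
  have hT := T_ineq ha'0 hB hs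
  have hEt : E (fun _ => t) B = (t : ℂ) • B := by
    have : dg (fun _ : Fin n => t ^ (1/2:ℝ)) = ((t ^ (1/2:ℝ) : ℝ) : ℂ) • 1 := by
      ext i j; simp [dg, diagonal_apply, one_apply]
    rw [E, this, Matrix.smul_mul, Matrix.one_mul, Matrix.smul_mul, Matrix.mul_smul, Matrix.mul_one,
      smul_smul, ← Complex.ofReal_mul, ← Real.sqrt_eq_rpow, Real.mul_self_sqrt ht0.le]
  have h3 : ∀ i, i.val < k + 1 →
      a i ^ (-s) * (pw (E a B) s i i).re ≤ a' i ^ (-s) * (pw (E a' B) s i i).re := by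
    intro i hi
    have := F_anti ha'0 (fun i => min_le_left (a i) t) hB hs i
    rw [h1 i hi] at this ⊢
    have := le_of_mul_le_mul_left this (inv_pos.2 (ha i))
    exact mul_le_mul_of_nonneg_left this (Real.rpow_nonneg (ha i).le _)
  have h4 : ∀ i : Fin n, ¬ i.val < k + 1 →
      (pw B s i i).re ≤ a' i ^ (-s) * (pw (E a' B) s i i).re := by
    intro i hi
    have := F_anti ha'0 (fun i => min_le_right (a i) t) hB hs i
    rw [hEt, pw_smul hB.posSemidef ht0.le] at this
    change t⁻¹ * _ ≤ (a' i)⁻¹ * _ at this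
    rw [h2 i hi] at this ⊢
    have := le_of_mul_le_mul_left this (inv_pos.2 ht0)
    rw [Matrix.smul_apply, smul_eq_mul, Complex.re_ofReal_mul] at this
    have h5 := mul_le_mul_of_nonneg_left this (Real.rpow_nonneg ht0.le (-s))
    rw [← mul_assoc, ← Real.rpow_add ht0] at h5
    simpa using h5
  rw [Finset.sum_sub_distrib, sub_nonneg]
  rw [← Finset.sum_filter_add_sum_filter_not Finset.univ (fun i : Fin n => i.val < k + 1),
    ← Finset.sum_filter_add_sum_filter_not (M := ℝ) Finset.univ (fun i : Fin n => i.val < k + 1) (fun i => (pw B s i i).re)] at hT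
  have h6 := Finset.sum_le_sum (fun i (hi : i ∈ Finset.univ.filter (fun i : Fin n => i.val < k + 1)) =>
    h3 i (by simpa using hi))
  have h7 := Finset.sum_le_sum (fun i (hi : i ∈ Finset.univ.filter (fun i : Fin n => ¬ i.val < k + 1)) =>
    h4 i (Finset.mem_filter.1 hi).2)
  linarith

lemma core_pd {a w : Fin n → ℝ} (ha : ∀ i, 0 < a i) (hm : Monotone a)
    {B : Matrix (Fin n) (Fin n) ℂ}
    (hB : B.PosDef) {s : ℝ} (hs : s ∈ Set.Icc (0:ℝ) 1)
    (h0 : ∀ i, 0 ≤ a i ^ s * w i) (h1 : Antitone (fun i => a i ^ s * w i)) :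
    ∑ i, w i * (pw (E a B) s i i).re ≤ ∑ i, w i * a i ^ s * (pw B s i i).re := by
  have := abel _ _ h1 h0 (partial_ineq ha hm hB hs)
  rw [← sub_nonneg, ← Finset.sum_sub_distrib]
  convert this using 2 with i
  have : a i ^ s * a i ^ (-s) = 1 := by rw [← Real.rpow_add (ha i)]; simp
  linear_combination (w i * (pw (E a B) s i i).re) * this

lemma core_psd {a w : Fin n → ℝ} (ha : ∀ i, 0 < a i) (hm : Monotone a)
    {B : Matrix (Fin n) (Fin n) ℂ}
    (hB : B.PosSemidef) {s : ℝ} (hs : s ∈ Set.Icc (0:ℝ) 1)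
    (h0 : ∀ i, 0 ≤ a i ^ s * w i) (h1 : Antitone (fun i => a i ^ s * w i)) :
    ∑ i, w i * (pw (E a B) s i i).re ≤ ∑ i, w i * a i ^ s * (pw B s i i).re := by
  have t1 := tend hs.1 hB (PosSemidef.one (n := Fin n) (R := ℂ))
  have t2 := tend hs.1 (E_psd a hB) (dg_psd (fun i => (ha i).le))
  have ent : ∀ i : Fin n, Continuous (fun M : Matrix (Fin n) (Fin n) ℂ => (M i i).re) := by
    intro i; fun_prop
  have t1' : Filter.Tendsto (fun e : ℝ => ∑ i, w i * a i ^ s * (pw (B + (e:ℂ) • 1) s i i).re)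
      (nhdsWithin 0 (Set.Ioi 0)) (nhds (∑ i, w i * a i ^ s * (pw B s i i).re)) :=
    tendsto_finsetSum _ fun i _ => (((ent i).tendsto _).comp t1).const_mul _
  have t2' : Filter.Tendsto (fun e : ℝ => ∑ i, w i * (pw (E a B + (e:ℂ) • dg a) s i i).re)
      (nhdsWithin 0 (Set.Ioi 0)) (nhds (∑ i, w i * (pw (E a B) s i i).re)) :=
    tendsto_finsetSum _ fun i _ => (((ent i).tendsto _).comp t2).const_mul _
  refine le_of_tendsto_of_tendsto t2' t1' ?_
  filter_upwards [self_mem_nhdsWithin] with e he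
  have hpd : (B + (e:ℂ) • 1).PosDef := by
    refine PosDef.posSemidef_add hB (PosDef.one.smul ?_)
    exact_mod_cast he
  have := core_pd ha hm hpd hs h0 h1
  have e1 : E a (B + (e:ℂ) • 1) = E a B + (e:ℂ) • dg a := by
    rw [E, E, Matrix.mul_add, Matrix.add_mul, Matrix.mul_smul, Matrix.mul_one, Matrix.smul_mul,
      dg_half (fun i => (ha i).le)]
  rwa [e1] at this

lemma core {a w : Fin n → ℝ} (ha : ∀ i, 0 ≤ a i) (hm : Monotone a)
    {B : Matrix (Fin n) (Fin n) ℂ}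
    (hB : B.PosSemidef) {s : ℝ} (hs : s ∈ Set.Icc (0:ℝ) 1)
    (h0 : ∀ i, 0 ≤ a i ^ s * w i) (h1 : Antitone (fun i => a i ^ s * w i)) :
    ∑ i, w i * (pw (E a B) s i i).re ≤ ∑ i, w i * a i ^ s * (pw B s i i).re := by
  by_cases hp : ∀ i, 0 < a i
  · exact core_psd hp hm hB hs h0 h1
  push Not at hp
  obtain ⟨i0, hi0⟩ := hp
  have hi0 : a i0 = 0 := le_antisymm hi0 (ha _)
  rcases eq_or_ne s 0 with rfl | hs0
  · simp [pw_zero hB.1, pw_zero (E_psd a hB).1]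
  have hz : ∀ j, a j ^ s * w j = 0 := by
    intro j
    rcases le_total i0 j with h | h
    · refine le_antisymm ?_ (h0 j)
      have := h1 h
      simpa [hi0, Real.zero_rpow hs0] using this
    · have : a j = 0 := le_antisymm (hi0 ▸ hm h) (ha j)
      simp [this, Real.zero_rpow hs0]
  apply le_of_eq
  refine Finset.sum_congr rfl fun j _ => ?_
  rw [mul_comm (w j) (a j ^ s), hz j, zero_mul]
  by_cases hj : a j = 0
  · have := cfc_inter' (E_psd a hB).1 (isHermitian_zero) (single j j (1:ℂ)) (by
      rw [Matrix.zero_mul, E]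
      have : single j j (1:ℂ) * dg (fun i => a i ^ (1/2:ℝ)) = 0 := by
        ext p q
        simp only [dg, mul_diagonal, single_apply, Matrix.zero_apply]
        split_ifs with h
        · rw [← h.2, hj]; simp
        · simp
      rw [← Matrix.mul_assoc, ← Matrix.mul_assoc, this, Matrix.zero_mul, Matrix.zero_mul])
      (fun x : ℝ => x ^ s)
    have z : cfc (fun x : ℝ => x ^ s) (0 : Matrix (Fin n) (Fin n) ℂ) = 0 := by
      have := cfc_dg (fun _ : Fin n => 0) (fun x : ℝ => x ^ s)
      simpa [dg, Real.zero_rpow hs0] using this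
    rw [z, Matrix.zero_mul] at this
    have h2 := congrFun (congrFun this j) j
    simp at h2
    simp [pw, h2]
  · have : a j ^ s ≠ 0 := (Real.rpow_pos_of_pos (lt_of_le_of_ne (ha j) (Ne.symm hj)) s).ne'
    have hw : w j = 0 := (mul_eq_zero.1 (hz j)).resolve_left this
    simp [hw]
end T
end ALT

theorem stmt_5 {n : ℕ} (A B : Matrix (Fin n) (Fin n) ℂ)
    (hA : A.PosSemidef) (hB : B.PosSemidef)
    (s : ℝ) (hs : s ∈ Set.Icc (0 : ℝ) 1)
    (J : Set ℝ) (hJ : J.OrdConnected) (hJA : spectrum ℝ A ⊆ J)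
    (g : ℝ → ℝ) (hg0 : ∀ x ∈ J, 0 ≤ x ^ s * g x)
    (hg1 : AntitoneOn (fun x => x ^ s * g x) J) :
    (Matrix.trace (mfun g A * mpow (mpow A (1/2) * B * mpow A (1/2)) s)).re ≤
      (Matrix.trace (mfun g A * mpow A s * mpow B s)).re := by
  obtain ⟨U, a, u1, u2, u3, hm, hsp, hps, -⟩ := ALT.spec_mono hA.1
  replace hps := hps hA
  have hc : ∀ f : ℝ → ℝ, cfc f A = U * ALT.dg (fun i => f (a i)) * U.conjTranspose := by
    intro f
    rw [u3, ALT.cfc_conj u1 u2 (ALT.dg_isH _), ALT.cfc_dg]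
  set B' := U.conjTranspose * B * U with hB'
  have hB'p : B'.PosSemidef := hB.conjTranspose_mul_mul_same U
  have hBB : B = U * B' * U.conjTranspose := by
    calc B = (U * U.conjTranspose) * B * (U * U.conjTranspose) := by
          rw [u2, Matrix.one_mul, Matrix.mul_one]
      _ = _ := by rw [hB']; simp only [Matrix.mul_assoc]
  have cj : ∀ X Y : Matrix (Fin n) (Fin n) ℂ, (U * X * U.conjTranspose) * (U * Y * U.conjTranspose)
      = U * (X * Y) * U.conjTranspose := by
    intro X Y
    calc _ = U * X * (U.conjTranspose * U) * Y * U.conjTranspose := by simp only [Matrix.mul_assoc]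
      _ = _ := by rw [u1, Matrix.mul_one]; simp only [Matrix.mul_assoc]
  have hBs : mpow B s = U * ALT.pw B' s * U.conjTranspose := by
    rw [hBB, mpow, ALT.cfc_conj u1 u2 hB'p.1]; rfl
  have hM : mpow A (1/2) * B * mpow A (1/2) = U * ALT.E a B' * U.conjTranspose := by
    rw [mpow, hc, hBB, cj, cj]; rfl
  have hMs : mpow (mpow A (1/2) * B * mpow A (1/2)) s = U * ALT.pw (ALT.E a B') s * U.conjTranspose := by
    rw [hM, mpow, ALT.cfc_conj u1 u2 (ALT.E_psd a hB'p).1]; rfl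
  rw [hMs, hBs, mfun, mpow, hc, hc, cj, cj, cj, ALT.trace_conj u1, ALT.trace_conj u1, ALT.dg_mul]
  have tr : ∀ (d : Fin n → ℝ) (M : Matrix (Fin n) (Fin n) ℂ),
      (Matrix.trace (ALT.dg d * M)).re = ∑ i, d i * (M i i).re := by
    intro d M
    rw [Matrix.trace, Complex.re_sum]
    refine Finset.sum_congr rfl fun i _ => ?_
    rw [Matrix.diag_apply, ALT.dg, Matrix.diagonal_mul, Complex.re_ofReal_mul]
  rw [tr, tr]
  exact ALT.core hps hm hB'p hs (fun i => hg0 _ (hJA (hsp i)))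
    (fun i j h => hg1 (hJA (hsp i)) (hJA (hsp j)) (hm h))
end

section
/- Let A and B be n×n complex positive semidefinite matrices, and let f : ℝ → ℝ be a function that is nonnegative and monotone nondecreasing on an interval J containing the spectrum of A. Then Tr[f(A) · (A^{1/2} B A^{1/2})^2] ≤ Tr[f(A) · A^2 · B^2]. -/
open scoped ComplexOrder

theorem diag_case {n : ℕ} (C : Matrix (Fin n) (Fin n) ℂ) (hC : C.IsHermitian)
    (a g s : Fin n → ℝ) (ha : ∀ i, 0 ≤ a i) (hg : ∀ i, 0 ≤ g i)
    (hs : ∀ i, s i * s i = a i) (hm : ∀ i j, a i ≤ a j → g i ≤ g j) :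
    (Matrix.trace (Matrix.diagonal (fun i => (g i : ℂ)) *
      (Matrix.diagonal (fun i => (s i : ℂ)) * C * Matrix.diagonal (fun i => (s i : ℂ))) ^ 2)).re ≤
    (Matrix.trace (Matrix.diagonal (fun i => (g i : ℂ)) *
      Matrix.diagonal (fun i => (a i : ℂ)) ^ 2 * C ^ 2)).re := by
  have hN : ∀ i j, C i j * C j i = (Complex.normSq (C i j) : ℂ) := by
    intro i j
    rw [← hC.apply j i, Complex.star_def, Complex.mul_conj]
  have hsym : ∀ i j, Complex.normSq (C i j) = Complex.normSq (C j i) := by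
    intro i j
    rw [← hC.apply j i, Complex.star_def, Complex.normSq_conj]
  have h1 : (Matrix.trace (Matrix.diagonal (fun i => (g i : ℂ)) *
      (Matrix.diagonal (fun i => (s i : ℂ)) * C * Matrix.diagonal (fun i => (s i : ℂ))) ^ 2)) =
      ((∑ i, ∑ j, g i * (a i * a j) * Complex.normSq (C i j) : ℝ) : ℂ) := by
    push_cast
    simp only [Matrix.trace, Matrix.diag, pow_two, Matrix.diagonal_mul]
    refine Finset.sum_congr rfl fun i _ => ?_
    rw [Matrix.mul_apply, Finset.mul_sum]
    refine Finset.sum_congr rfl fun j _ => ?_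
    simp only [Matrix.diagonal_mul, Matrix.mul_diagonal]
    rw [← hN, ← hs i, ← hs j]
    push_cast
    ring
  have h2 : (Matrix.trace (Matrix.diagonal (fun i => (g i : ℂ)) *
      Matrix.diagonal (fun i => (a i : ℂ)) ^ 2 * C ^ 2)) =
      ((∑ i, ∑ j, g i * (a i * a i) * Complex.normSq (C i j) : ℝ) : ℂ) := by
    push_cast
    simp only [Matrix.trace, Matrix.diag, pow_two, Matrix.diagonal_mul_diagonal,
      Matrix.diagonal_mul]
    refine Finset.sum_congr rfl fun i _ => ?_
    rw [Matrix.mul_apply, Finset.mul_sum]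
    refine Finset.sum_congr rfl fun j _ => ?_
    rw [← hN]
  rw [h1, h2, Complex.ofReal_re, Complex.ofReal_re]
  have c1 : (∑ i, ∑ j, g i * (a i * a j) * Complex.normSq (C i j)) =
      ∑ i, ∑ j, g j * (a i * a j) * Complex.normSq (C i j) := by
    rw [Finset.sum_comm]
    refine Finset.sum_congr rfl fun i _ => Finset.sum_congr rfl fun j _ => ?_
    rw [hsym j i]; ring
  have c2 : (∑ i, ∑ j, g i * (a i * a i) * Complex.normSq (C i j)) =
      ∑ i, ∑ j, g j * (a j * a j) * Complex.normSq (C i j) := by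
    rw [Finset.sum_comm]
    refine Finset.sum_congr rfl fun i _ => Finset.sum_congr rfl fun j _ => ?_
    rw [hsym j i]
  have key : (∑ i, ∑ j, g i * (a i * a j) * Complex.normSq (C i j)) +
      (∑ i, ∑ j, g j * (a i * a j) * Complex.normSq (C i j)) ≤
      (∑ i, ∑ j, g i * (a i * a i) * Complex.normSq (C i j)) +
      ∑ i, ∑ j, g j * (a j * a j) * Complex.normSq (C i j) := by
    simp only [← Finset.sum_add_distrib]
    refine Finset.sum_le_sum fun i _ => Finset.sum_le_sum fun j _ => ?_
    simp only [← add_mul (_ * (_ * _)) (_ * (_ * _)) (Complex.normSq _)]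
    refine mul_le_mul_of_nonneg_right ?_ (Complex.normSq_nonneg _)
    have : 0 ≤ (g i * a i - g j * a j) * (a i - a j) := by
      rcases le_total (a i) (a j) with h | h
      · exact mul_nonneg_of_nonpos_of_nonpos
          (sub_nonpos.2 (mul_le_mul (hm i j h) h (ha i) (hg j))) (sub_nonpos.2 h)
      · exact mul_nonneg
          (sub_nonneg.2 (mul_le_mul (hm j i h) h (ha j) (hg i))) (sub_nonneg.2 h)
    nlinarith
  linarith

/-- Proposition (case `s = 2`): for `A, B` positive semidefinite and `f` nonnegative and
nondecreasing on an interval `J` containing the spectrum of `A`: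
`Tr[f(A) (A^{1/2} B A^{1/2})^2] ≤ Tr[f(A) A^2 B^2]`. -/
theorem stmt_6 {n : ℕ} (A B : Matrix (Fin n) (Fin n) ℂ)
    (hA : A.PosSemidef) (hB : B.PosSemidef)
    (J : Set ℝ) (hJ : J.OrdConnected) (hJA : spectrum ℝ A ⊆ J)
    (f : ℝ → ℝ) (hf0 : ∀ x ∈ J, 0 ≤ f x) (hf1 : MonotoneOn f J) :
    (Matrix.trace (mfun f A * (mpow A (1/2) * B * mpow A (1/2)) ^ 2)).re ≤
      (Matrix.trace (mfun f A * A ^ 2 * B ^ 2)).re := by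
  have hH := hA.1
  have hcfc : ∀ h : ℝ → ℝ, cfc h A = Unitary.conjStarAlgAut ℂ _ hH.eigenvectorUnitary
      (Matrix.diagonal (fun i => (h (hH.eigenvalues i) : ℂ))) := fun h => hH.cfc_eq h
  have hA' : A = Unitary.conjStarAlgAut ℂ _ hH.eigenvectorUnitary
      (Matrix.diagonal (fun i => (hH.eigenvalues i : ℂ))) := hH.spectral_theorem
  have htr : ∀ X, Matrix.trace (Unitary.conjStarAlgAut ℂ _ hH.eigenvectorUnitary X) =
      Matrix.trace X := by
    intro X
    rw [Unitary.conjStarAlgAut_apply, Matrix.trace_mul_comm, ← mul_assoc]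
    simp
  have ha : ∀ i, 0 ≤ hH.eigenvalues i := hA.eigenvalues_nonneg
  have hJ' : ∀ i, hH.eigenvalues i ∈ J := fun i => hJA (hH.eigenvalues_mem_spectrum_real i)
  obtain ⟨C, hC⟩ : ∃ C, Unitary.conjStarAlgAut ℂ _ hH.eigenvectorUnitary C = B :=
    EquivLike.surjective (Unitary.conjStarAlgAut ℂ _ hH.eigenvectorUnitary) B
  have hCH : C.IsHermitian := by
    apply EquivLike.injective (Unitary.conjStarAlgAut ℂ _ hH.eigenvectorUnitary)
    rw [← Matrix.star_eq_conjTranspose, map_star, hC]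
    exact hB.1
  have e1 : mfun f A * (mpow A (1/2) * B * mpow A (1/2)) ^ 2 =
      Unitary.conjStarAlgAut ℂ _ hH.eigenvectorUnitary
      (Matrix.diagonal (fun i => (f (hH.eigenvalues i) : ℂ)) *
      (Matrix.diagonal (fun i => ((hH.eigenvalues i ^ (1/2 : ℝ) : ℝ) : ℂ)) * C *
        Matrix.diagonal (fun i => ((hH.eigenvalues i ^ (1/2 : ℝ) : ℝ) : ℂ))) ^ 2) := by
    rw [mfun, mpow, hcfc, hcfc, map_mul, map_pow, map_mul, map_mul, hC]
  have e2 : mfun f A * A ^ 2 * B ^ 2 =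
      Unitary.conjStarAlgAut ℂ _ hH.eigenvectorUnitary
      (Matrix.diagonal (fun i => (f (hH.eigenvalues i) : ℂ)) *
      Matrix.diagonal (fun i => (hH.eigenvalues i : ℂ)) ^ 2 * C ^ 2) := by
    rw [map_mul, map_mul, map_pow, map_pow, ← hA', hC, mfun, hcfc]
  rw [e1, e2, htr, htr]
  refine diag_case C hCH _ (fun i => f (hH.eigenvalues i)) _ ha (fun i => hf0 _ (hJ' i)) ?_
    (fun i j h => hf1 (hJ' i) (hJ' j) h)
  intro i
  rw [← Real.sqrt_eq_rpow, Real.mul_self_sqrt (ha i)]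
end

section
/- Let A be an n×n complex positive semidefinite matrix with spectral decomposition A = Σ_{i=1}^n λ_i P_i, λ_1 ≥ ⋯ ≥ λ_n ≥ 0, let Π_k := Σ_{i=1}^k P_i, and let Ã_k := Π_k A + λ_k (I − Π_k). Then for every n×n complex positive semidefinite matrix B: Tr[Π_k · (Ã_k^{1/2} B Ã_k^{1/2})^2] ≤ Tr[Π_k · Ã_k^2 · B^2]. -/
open scoped ComplexOrder

noncomputable def dg {n : ℕ} (P : Fin n → Matrix (Fin n) (Fin n) ℂ) (f : Fin n → ℝ) :
    Matrix (Fin n) (Fin n) ℂ := ∑ i, (f i : ℂ) • P i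

lemma dg_mul {n : ℕ} (P : Fin n → Matrix (Fin n) (Fin n) ℂ)
    (hPidem : ∀ i, P i * P i = P i)
    (hPorth : ∀ i j, i ≠ j → P i * P j = 0) (f g : Fin n → ℝ) :
    dg P f * dg P g = dg P (fun i => f i * g i) := by
  unfold dg
  rw [Finset.sum_mul]
  refine Finset.sum_congr rfl fun i _ => ?_
  rw [Finset.mul_sum, Finset.sum_eq_single i]
  · rw [smul_mul_smul_comm, hPidem]; push_cast; rfl
  · intro j _ hj
    rw [smul_mul_smul_comm, hPorth i j hj.symm, smul_zero]
  · simp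

lemma dg_trace {n : ℕ} (P : Fin n → Matrix (Fin n) (Fin n) ℂ)
    (B : Matrix (Fin n) (Fin n) ℂ) (f g : Fin n → ℝ) :
    (Matrix.trace (dg P f * B * (dg P g * B))).re =
      ∑ i, ∑ j, f i * g j * (Matrix.trace (P i * B * (P j * B))).re := by
  unfold dg
  simp only [Finset.sum_mul, Finset.mul_sum, Matrix.trace_sum, Complex.re_sum,
    smul_mul_assoc, mul_smul_comm, Matrix.trace_smul, smul_eq_mul, Complex.re_ofReal_mul]
  rw [Finset.sum_comm]
  refine Finset.sum_congr rfl fun i _ => Finset.sum_congr rfl fun j _ => ?_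
  ring

lemma dg_psd {n : ℕ} (P : Fin n → Matrix (Fin n) (Fin n) ℂ)
    (hPherm : ∀ i, (P i).IsHermitian)
    (hPidem : ∀ i, P i * P i = P i) (f : Fin n → ℝ) (hf : ∀ i, 0 ≤ f i) :
    (dg P f).PosSemidef := by
  unfold dg
  refine Matrix.posSemidef_sum _ fun i _ => ?_
  refine Matrix.PosSemidef.smul ?_ (by exact_mod_cast hf i)
  have := Matrix.posSemidef_conjTranspose_mul_self (P i)
  rwa [(hPherm i).eq, hPidem] at this

lemma mpow_half {n : ℕ} (T : Matrix (Fin n) (Fin n) ℂ) (hT : T.PosSemidef) :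
    mpow (T ^ 2) (1/2) = T := by
  unfold mpow
  have hsa : IsSelfAdjoint T := hT.isHermitian
  rw [← cfc_comp_pow (fun x : ℝ => x ^ (1/2 : ℝ)) 2 T
    (Real.continuous_rpow_const (by norm_num)).continuousOn hsa]
  conv_rhs => rw [← cfc_id ℝ T hsa]
  refine cfc_congr fun x hx => ?_
  have hx0 : 0 ≤ x := by
    rw [hT.isHermitian.spectrum_real_eq_range_eigenvalues] at hx
    obtain ⟨i, rfl⟩ := hx
    exact hT.eigenvalues_nonneg i
  simp only [id]
  rw [← Real.sqrt_eq_rpow, Real.sqrt_sq hx0]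

lemma coef_nonneg {n : ℕ} (P Q B : Matrix (Fin n) (Fin n) ℂ) (hB : B.IsHermitian)
    (hP : P.IsHermitian) (hQ : Q.IsHermitian) (hPP : P * P = P) (hQQ : Q * Q = Q) :
    0 ≤ (Matrix.trace (P * B * (Q * B))).re := by
  have h := (Matrix.posSemidef_self_mul_conjTranspose (P * B * Q)).trace_nonneg
  have e : Matrix.trace (P * B * Q * (P * B * Q).conjTranspose)
      = Matrix.trace (P * B * (Q * B)) := by
    rw [Matrix.conjTranspose_mul, Matrix.conjTranspose_mul, hP.eq, hQ.eq, hB.eq]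
    calc _ = Matrix.trace ((P * B * (Q * Q) * B) * P) := by simp only [mul_assoc]
      _ = _ := by
        rw [Matrix.trace_mul_comm, hQQ]
        simp only [← mul_assoc]
        rw [hPP]
  rw [e] at h
  exact (Complex.le_def.1 h).1

lemma sum_ineq {n : ℕ} (k : Fin n) (m : Fin n → ℝ) (c : Fin n → Fin n → ℝ)
    (hm : ∀ i, 0 ≤ m i) (hmk : ∀ i j, i ≤ k → ¬ j ≤ k → m j ≤ m i)
    (hc : ∀ i j, 0 ≤ c i j) (hs : ∀ i j, c i j = c j i) (e : Fin n → ℝ)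
    (he : e = fun i => if i ≤ k then 1 else 0) :
    ∑ i, ∑ j, (m i * e i) * m j * c i j ≤ ∑ i, ∑ j, (e i * (m i * m i)) * 1 * c i j := by
  set F : Fin n → Fin n → ℝ := fun i j => e i * m i * (m i - m j) * c i j with hF
  have h1 : ∑ i, ∑ j, (e i * (m i * m i)) * 1 * c i j - ∑ i, ∑ j, (m i * e i) * m j * c i j
      = ∑ i, ∑ j, F i j := by
    rw [← Finset.sum_sub_distrib]
    refine Finset.sum_congr rfl fun i _ => ?_
    rw [← Finset.sum_sub_distrib]
    refine Finset.sum_congr rfl fun j _ => ?_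
    simp only [hF]; ring
  have h2 : 0 ≤ ∑ i, ∑ j, (F i j + F j i) := by
    refine Finset.sum_nonneg fun i _ => Finset.sum_nonneg fun j _ => ?_
    simp only [hF, he]
    rw [hs j i]
    by_cases hi : i ≤ k <;> by_cases hj : j ≤ k <;> simp only [hi, hj, if_true, if_false]
    · have := mul_nonneg (sq_nonneg (m i - m j)) (hc i j)
      nlinarith
    · have := mul_nonneg (mul_nonneg (hm i) (sub_nonneg.2 (hmk i j hi hj))) (hc i j)
      nlinarith
    · have := mul_nonneg (mul_nonneg (hm j) (sub_nonneg.2 (hmk j i hj hi))) (hc i j)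
      nlinarith
    · simp
  have h3 : ∑ i, ∑ j, (F i j + F j i) = 2 * ∑ i, ∑ j, F i j := by
    simp only [Finset.sum_add_distrib]
    rw [Finset.sum_comm (f := fun i j => F j i)]
    ring
  linarith

/-- Lemma 7: with `A = Σ_i λ_i P_i` a spectral decomposition with eigenvalues in nonincreasing
order, `Π_k = Σ_{i ≤ k} P_i` and `Ã_k = Π_k A + λ_k (I - Π_k)`, for all PSD `B`:
`Tr[Π_k (Ã_k^{1/2} B Ã_k^{1/2})^2] ≤ Tr[Π_k Ã_k^2 B^2]`. -/
theorem stmt_7 {n : ℕ} (A B : Matrix (Fin n) (Fin n) ℂ) (hB : B.PosSemidef)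
    (lam : Fin n → ℝ) (P : Fin n → Matrix (Fin n) (Fin n) ℂ)
    (hlam : Antitone lam) (hlam0 : ∀ i, 0 ≤ lam i)
    (hPherm : ∀ i, (P i).IsHermitian)
    (hPidem : ∀ i, P i * P i = P i)
    (hPorth : ∀ i j, i ≠ j → P i * P j = 0)
    (hPsum : ∑ i, P i = 1)
    (hA : A = ∑ i, (lam i : ℂ) • P i)
    (k : Fin n)
    (Pik Atk : Matrix (Fin n) (Fin n) ℂ)
    (hPik : Pik = ∑ i ∈ Finset.Iic k, P i)
    (hAtk : Atk = Pik * A + (lam k : ℂ) • (1 - Pik)) :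
    (Matrix.trace (Pik * (mpow Atk (1/2) * B * mpow Atk (1/2)) ^ 2)).re ≤
      (Matrix.trace (Pik * Atk ^ 2 * B ^ 2)).re := by
  set e : Fin n → ℝ := fun i => if i ≤ k then 1 else 0 with he
  set m : Fin n → ℝ := fun i => if i ≤ k then lam i else lam k with hm
  set s : Fin n → ℝ := fun i => Real.sqrt (m i) with hs
  have hm0 : ∀ i, 0 ≤ m i := by
    intro i; simp only [hm]; split_ifs
    exacts [hlam0 i, hlam0 k]
  have hmul := dg_mul P hPidem hPorth
  have hss : dg P s * dg P s = dg P m := by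
    rw [hmul]; congr 1; funext i; exact Real.mul_self_sqrt (hm0 i)
  have h1 : dg P (fun _ => 1) = 1 := by simp [dg, hPsum]
  have hPe : Pik = dg P e := by
    rw [hPik]
    simp only [dg, he]
    rw [← Finset.sum_subset (Finset.subset_univ (Finset.Iic k))]
    · refine Finset.sum_congr rfl fun i hi => ?_
      simp [Finset.mem_Iic.1 hi]
    · intro i _ hi
      rw [Finset.mem_Iic] at hi
      simp [hi]
  have hAm : Atk = dg P m := by
    have hA' : A = dg P lam := hA
    rw [hAtk, hPe, hA', hmul, ← h1]
    simp only [dg]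
    rw [← Finset.sum_sub_distrib, Finset.smul_sum, ← Finset.sum_add_distrib]
    refine Finset.sum_congr rfl fun i _ => ?_
    by_cases hi : i ≤ k <;> simp [he, hm, hi]
  have hS : mpow Atk (1/2) = dg P s := by
    rw [hAm, ← hss, ← pow_two]
    exact mpow_half _ (dg_psd P hPherm hPidem s fun i => Real.sqrt_nonneg _)
  rw [hS, hPe, hAm]
  have hL : Matrix.trace (dg P e * (dg P s * B * dg P s) ^ 2)
      = Matrix.trace (dg P (fun i => m i * e i) * B * (dg P m * B)) := by
    have hse : dg P s * (dg P e * dg P s) = dg P (fun i => m i * e i) := by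
      rw [hmul, hmul]; congr 1; funext i
      have := Real.mul_self_sqrt (hm0 i)
      simp only [hs]; linear_combination e i * this
    rw [← hse, ← hss]
    calc _ = Matrix.trace ((dg P e * dg P s * B * (dg P s * dg P s) * B) * dg P s) := by
          simp only [pow_two, mul_assoc]
      _ = _ := by rw [Matrix.trace_mul_comm]; simp only [mul_assoc]
  have hR : dg P e * dg P m ^ 2 * B ^ 2
      = dg P (fun i => e i * (m i * m i)) * B * (dg P (fun _ => 1) * B) := by
    rw [h1, one_mul, pow_two, pow_two, hmul, hmul, mul_assoc _ B B]
  rw [hL, hR, dg_trace, dg_trace]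
  refine sum_ineq k m _ hm0 ?_ ?_ ?_ e he
  · intro i j hi hj
    simp only [hm, hi, hj, if_true, if_false]
    exact hlam hi
  · intro i j
    exact coef_nonneg _ _ B hB.isHermitian (hPherm i) (hPherm j) (hPidem i) (hPidem j)
  · intro i j
    rw [Matrix.trace_mul_comm]
end

section
/- There exist 2×2 complex positive semidefinite matrices A and B and an orthogonal projection P onto an eigenspace of A such that Tr[P · A^{1/2} · B^{1/2}] > Tr[P · (A^{1/2} B A^{1/2})^{1/2}]. Concretely, this holds for A = diag(2,1), B the all-ones 2×2 matrix, and P = diag(0,1), the projection onto the eigenspace of A for the eigenvalue 1; in this case Tr[P A^{1/2} B^{1/2}] = 1/√2 ≈ 0.7071 while Tr[P (A^{1/2} B A^{1/2})^{1/2}] ≈ 0.5774. -/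
open scoped ComplexOrder

theorem mpow_half_of_sq {A C : Matrix (Fin 2) (Fin 2) ℂ} (hC : C.PosSemidef) (h : C ^ 2 = A) :
    mpow A (1/2) = C := by
  have hsa : IsSelfAdjoint C := hC.isHermitian
  have hsp := (Matrix.posSemidef_iff_isHermitian_and_spectrum_nonneg.mp hC).2
  have hc : Continuous (fun x : ℝ => x ^ (1/2 : ℝ)) :=
    Real.continuous_rpow_const (by norm_num)
  unfold mpow
  rw [← h, ← cfc_comp_pow (fun x : ℝ => x ^ (1/2 : ℝ)) 2 C hc.continuousOn hsa]
  conv_rhs => rw [← cfc_id' ℝ C hsa]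
  apply cfc_congr
  intro x hx
  have hx0 : 0 ≤ x := by
    have h1 : (algebraMap ℝ ℂ x) ∈ spectrum ℂ C := spectrum.algebraMap_mem ℂ hx
    have h2 := hsp h1
    simpa using h2
  simp only
  rw [← Real.sqrt_eq_rpow, Real.sqrt_sq hx0]

theorem psd_of_rank1 (a b c : ℝ) (hc : 0 ≤ c) :
    (!![(c * (a * a) : ℂ), c * (a * b); c * (b * a), c * (b * b)] :
      Matrix (Fin 2) (Fin 2) ℂ).PosSemidef := by
  have h := (Matrix.posSemidef_vecMulVec_self_star ![(a : ℂ), (b : ℂ)]).smul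
    (show (0 : ℂ) ≤ (c : ℂ) by exact_mod_cast hc)
  convert h using 1
  ext i j
  fin_cases i <;> fin_cases j <;> simp [Matrix.vecMulVec]

theorem psd_diag (a b : ℝ) (ha : 0 ≤ a) (hb : 0 ≤ b) :
    (!![(a : ℂ), 0; 0, b] : Matrix (Fin 2) (Fin 2) ℂ).PosSemidef := by
  have h : (Matrix.diagonal ![(a : ℂ), (b : ℂ)]).PosSemidef := by
    apply Matrix.PosSemidef.diagonal
    intro i
    fin_cases i
    · simpa using ha
    · simpa using hb
  convert h using 1
  ext i j
  fin_cases i <;> fin_cases j <;> simp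

/-- Counterexample: there exist 2×2 PSD matrices `A`, `B` and an orthogonal projection `P` onto
an eigenspace of `A` with `Tr[P A^{1/2} B^{1/2}] > Tr[P (A^{1/2} B A^{1/2})^{1/2}]`; concretely
`A = diag(2,1)`, `B` the all-ones matrix, and `P = diag(0,1)`. -/
theorem stmt_8 :
    ∃ A B P : Matrix (Fin 2) (Fin 2) ℂ,
      A.PosSemidef ∧ B.PosSemidef ∧
      A = !![2, 0; 0, 1] ∧ B = !![1, 1; 1, 1] ∧ P = !![0, 0; 0, 1] ∧
      (Matrix.trace (P * mpow A (1/2) * mpow B (1/2))).re >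
        (Matrix.trace (P * mpow (mpow A (1/2) * B * mpow A (1/2)) (1/2))).re := by
  have s2 : ((√2 : ℝ) : ℂ) * (√2 : ℝ) = 2 := by
    rw [← Complex.ofReal_mul, Real.mul_self_sqrt (by norm_num)]; simp
  have t2 : (((√2)⁻¹ : ℝ) : ℂ) * ((√2)⁻¹ : ℝ) * 2 = 1 := by
    rw [← Complex.ofReal_mul, ← mul_inv, Real.mul_self_sqrt (by norm_num)]; simp
  have t3 : (((√3)⁻¹ : ℝ) : ℂ) * ((√3)⁻¹ : ℝ) * 3 = 1 := by
    rw [← Complex.ofReal_mul, ← mul_inv, Real.mul_self_sqrt (by norm_num)]; simp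
  have hA : mpow (!![2, 0; 0, 1] : Matrix (Fin 2) (Fin 2) ℂ) (1/2)
      = !![((√2 : ℝ) : ℂ), 0; 0, ((1 : ℝ) : ℂ)] := by
    apply mpow_half_of_sq (psd_diag _ _ (Real.sqrt_nonneg _) zero_le_one)
    rw [pow_two, Matrix.mul_fin_two, s2]
    simp
  have hB := mpow_half_of_sq (A := !![1, 1; 1, 1])
    (psd_of_rank1 1 1 (√2)⁻¹ (inv_nonneg.mpr (Real.sqrt_nonneg _))) (by
      rw [pow_two, Matrix.mul_fin_two]
      generalize (((√2)⁻¹ : ℝ) : ℂ) = t at *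
      push_cast
      congr! <;> linear_combination t2)
  have hM := mpow_half_of_sq
    (A := !![((√2 : ℝ) : ℂ), 0; 0, ((1 : ℝ) : ℂ)] * !![1, 1; 1, 1]
      * !![((√2 : ℝ) : ℂ), 0; 0, ((1 : ℝ) : ℂ)])
    (psd_of_rank1 (√2) 1 (√3)⁻¹ (inv_nonneg.mpr (Real.sqrt_nonneg _))) (by
      rw [pow_two, Matrix.mul_fin_two, Matrix.mul_fin_two, Matrix.mul_fin_two]
      generalize (((√3)⁻¹ : ℝ) : ℂ) = t at *
      generalize ((√2 : ℝ) : ℂ) = r at *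
      push_cast
      ext i j
      fin_cases i <;> fin_cases j <;> simp
      · linear_combination (r * r) * t3 + t * t * r * r * s2
      · linear_combination r * t3 + t * t * r * s2
      · linear_combination r * t3 + t * t * r * s2
      · linear_combination t3 + t * t * s2)
  refine ⟨_, _, _, ?_, ?_, rfl, rfl, rfl, ?_⟩
  · simpa using psd_diag 2 1 (by norm_num) (by norm_num)
  · simpa using psd_of_rank1 1 1 1 (by norm_num)
  · rw [hA, hB, hM, Matrix.mul_fin_two, Matrix.mul_fin_two, Matrix.mul_fin_two,
      Matrix.trace_fin_two_of, Matrix.trace_fin_two_of]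
    have hlt : (√3)⁻¹ < (√2)⁻¹ :=
      inv_strictAnti₀ (by positivity) (Real.sqrt_lt_sqrt (by norm_num) (by norm_num))
    generalize (√3)⁻¹ = u at *
    generalize (√2)⁻¹ = v at *
    simpa using hlt
end

section
/- (Araki–Lieb–Thirring trace inequality, direct direction.) Let A and B be n×n complex positive semidefinite matrices. Then for every real r ≥ 1: Tr[(A^{1/2} B A^{1/2})^r] ≤ Tr[A^{r/2} · B^r · A^{r/2}]. -/
open scoped ComplexOrder

section
open Matrix

/-- complex power with `0 ↦ 0`, entire in the exponent -/
noncomputable def altCp (m : ℝ) (z : ℂ) : ℂ := if m = 0 then 0 else Complex.exp (z * (Real.log m : ℂ))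

lemma altCp_norm {m : ℝ} (hm : 0 ≤ m) (z : ℂ) : ‖altCp m z‖ = if m = 0 then 0 else m ^ z.re := by
  unfold altCp
  split_ifs with h
  · simp
  · rw [Complex.norm_exp, Real.rpow_def_of_pos (lt_of_le_of_ne hm (Ne.symm h))]
    simp [mul_comm]

lemma altCp_ofReal {m : ℝ} (hm : 0 ≤ m) {x : ℝ} (hx : x ≠ 0) : altCp m x = ((m ^ x : ℝ) : ℂ) := by
  unfold altCp
  split_ifs with h
  · simp [h, Real.zero_rpow hx]
  · rw [Real.rpow_def_of_pos (lt_of_le_of_ne hm (Ne.symm h))]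
    push_cast
    rw [mul_comm]

lemma altCp_star_mul {m : ℝ} (hm : 0 ≤ m) {z : ℂ} {x : ℝ} (hx : x ≠ 0) (hz : z.re = x / 2) :
    star (altCp m z) * altCp m z = ((m ^ x : ℝ) : ℂ) := by
  have : star (altCp m z) * altCp m z = ((‖altCp m z‖ ^ 2 : ℝ) : ℂ) := by
    rw [Complex.star_def, Complex.conj_mul']; push_cast; rfl
  rw [this, altCp_norm hm]
  congr 1
  split_ifs with h
  · simp [h, Real.zero_rpow hx]
  · rw [hz, ← Real.rpow_natCast, ← Real.rpow_mul hm]; congr 1; push_cast; ring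

/-- entire and bounded on the strip -/
def altGood (f : ℂ → ℂ) : Prop :=
  Differentiable ℂ f ∧ ∃ K : ℝ, ∀ z : ℂ, 0 ≤ z.re → z.re ≤ 1 → ‖f z‖ ≤ K

lemma altGood_const (c : ℂ) : altGood (fun _ => c) := ⟨by fun_prop, ‖c‖, fun _ _ _ => le_rfl⟩

lemma altGood_mul {f g : ℂ → ℂ} (hf : altGood f) (hg : altGood g) : altGood (fun z => f z * g z) := by
  obtain ⟨hf, K, hK⟩ := hf
  obtain ⟨hg, L, hL⟩ := hg
  refine ⟨hf.mul hg, K * L, fun z h0 h1 => ?_⟩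
  rw [norm_mul]
  exact mul_le_mul (hK z h0 h1) (hL z h0 h1) (norm_nonneg _) ((norm_nonneg _).trans (hK z h0 h1))

lemma altGood_sum {ι : Type*} (s : Finset ι) {f : ι → ℂ → ℂ} (hf : ∀ i, altGood (f i)) :
    altGood (fun z => ∑ i ∈ s, f i z) := by
  choose h K hK using hf
  refine ⟨Differentiable.fun_sum fun i _ => h i, ∑ i ∈ s, K i, fun z h0 h1 => ?_⟩
  exact (norm_sum_le _ _).trans (Finset.sum_le_sum fun i _ => hK i z h0 h1)

lemma altGood_cp (m : ℝ) (a b : ℝ) : altGood (fun z => altCp m (a + z * b)) := by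
  constructor
  · unfold altCp
    split_ifs <;> fun_prop
  · refine ⟨Real.exp (|a * Real.log m| + |b * Real.log m|), fun z h0 h1 => ?_⟩
    unfold altCp
    split_ifs with h
    · simp; positivity
    · rw [Complex.norm_exp, Real.exp_le_exp]
      have : ((a + z * b) * (Real.log m : ℂ)).re = a * Real.log m + z.re * (b * Real.log m) := by
        simp; ring
      rw [this]
      have h2 : z.re * (b * Real.log m) ≤ |b * Real.log m| := by
        calc _ ≤ z.re * |b * Real.log m| := by gcongr; exact le_abs_self _
          _ ≤ 1 * |b * Real.log m| := by gcongr
          _ = _ := one_mul _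
      linarith [le_abs_self (a * Real.log m)]

variable {n : ℕ}

/-- `U diag(d) U*` -/
noncomputable def altSP (U : unitaryGroup (Fin n) ℂ) (d : Fin n → ℂ) : Matrix (Fin n) (Fin n) ℂ :=
  (U : Matrix (Fin n) (Fin n) ℂ) * diagonal d * (U : Matrix (Fin n) (Fin n) ℂ)ᴴ

lemma altU (U : unitaryGroup (Fin n) ℂ) :
    (U : Matrix (Fin n) (Fin n) ℂ)ᴴ * (U : Matrix (Fin n) (Fin n) ℂ) = 1 :=
  Unitary.coe_star_mul_self U

lemma altU' (U : unitaryGroup (Fin n) ℂ) :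
    (U : Matrix (Fin n) (Fin n) ℂ) * (U : Matrix (Fin n) (Fin n) ℂ)ᴴ = 1 :=
  Unitary.coe_mul_star_self U

lemma altSP_mul (U : unitaryGroup (Fin n) ℂ) (d e : Fin n → ℂ) :
    altSP U d * altSP U e = altSP U (fun i => d i * e i) := by
  unfold altSP
  calc _ = (U : Matrix (Fin n) (Fin n) ℂ) * diagonal d * ((U : Matrix (Fin n) (Fin n) ℂ)ᴴ * (U : Matrix (Fin n) (Fin n) ℂ)) * diagonal e * (U : Matrix (Fin n) (Fin n) ℂ)ᴴ := by
        simp only [Matrix.mul_assoc]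
    _ = _ := by rw [altU, Matrix.mul_one, Matrix.mul_assoc _ (diagonal d), diagonal_mul_diagonal]

lemma altSP_star (U : unitaryGroup (Fin n) ℂ) (d : Fin n → ℂ) :
    (altSP U d)ᴴ = altSP U (fun i => star (d i)) := by
  unfold altSP
  rw [conjTranspose_mul, conjTranspose_mul, conjTranspose_conjTranspose, diagonal_conjTranspose,
    Matrix.mul_assoc]
  rfl

lemma alt_mpow {A : Matrix (Fin n) (Fin n) ℂ} (hA : A.IsHermitian) (s : ℝ) :
    mpow A s = altSP hA.eigenvectorUnitary (fun i => ((hA.eigenvalues i ^ s : ℝ) : ℂ)) := by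
  unfold mpow
  rw [hA.cfc_eq]
  rfl

lemma alt_spec {A : Matrix (Fin n) (Fin n) ℂ} (hA : A.IsHermitian) :
    A = altSP hA.eigenvectorUnitary (fun i => ((hA.eigenvalues i : ℝ) : ℂ)) :=
  hA.spectral_theorem

section
open scoped Matrix.Norms.L2Operator

lemma alt_U_norm (U : unitaryGroup (Fin n) ℂ) : ‖(U : Matrix (Fin n) (Fin n) ℂ)‖ ≤ 1 := by
  have h := l2_opNorm_conjTranspose_mul_self (U : Matrix (Fin n) (Fin n) ℂ)
  rw [altU, ← diagonal_one, l2_opNorm_diagonal] at h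
  have h1 : ‖(fun _ : Fin n => (1:ℂ))‖ ≤ 1 := by
    rw [pi_norm_le_iff_of_nonneg zero_le_one]; simp
  nlinarith

lemma alt_SP_norm (U : unitaryGroup (Fin n) ℂ) (d : Fin n → ℂ) (hd : ∀ i, ‖d i‖ ≤ 1) :
    ‖altSP U d‖ ≤ 1 := by
  have hd' : ‖d‖ ≤ 1 := by rwa [pi_norm_le_iff_of_nonneg zero_le_one]
  unfold altSP
  refine (l2_opNorm_mul _ _).trans (mul_le_one₀ ((l2_opNorm_mul _ _).trans
    (mul_le_one₀ (alt_U_norm U) (norm_nonneg _) ?_)) (norm_nonneg _) ?_)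
  · rwa [l2_opNorm_diagonal]
  · rw [l2_opNorm_conjTranspose]; exact alt_U_norm U

lemma alt_col (Y : Matrix (Fin n) (Fin n) ℂ) (k : Fin n) : ∑ i, ‖Y i k‖ ^ 2 ≤ ‖Y‖ ^ 2 := by
  have h := l2_opNorm_mulVec Y (EuclideanSpace.single k 1)
  have h2 : ‖EuclideanSpace.single k (1:ℂ)‖ = 1 := by simp
  rw [h2, mul_one] at h
  have h3 := pow_le_pow_left₀ (norm_nonneg _) h 2
  rw [EuclideanSpace.norm_sq_eq] at h3
  simpa using h3

/-- contraction products have columns of norm at most one -/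
lemma alt_contr (U V W : unitaryGroup (Fin n) ℂ) (d e : Fin n → ℂ) (hd : ∀ i, ‖d i‖ ≤ 1)
    (he : ∀ i, ‖e i‖ ≤ 1) (k : Fin n) :
    ∑ i, ‖(altSP V e * altSP U d * (W : Matrix (Fin n) (Fin n) ℂ)) i k‖ ^ 2 ≤ 1 := by
  refine (alt_col _ k).trans (pow_le_one₀ (norm_nonneg _) ?_)
  exact (l2_opNorm_mul _ _).trans (mul_le_one₀ ((l2_opNorm_mul _ _).trans
    (mul_le_one₀ (alt_SP_norm _ _ he) (norm_nonneg _) (alt_SP_norm _ _ hd))) (norm_nonneg _)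
    (alt_U_norm W))
end

lemma alt_sum_col (Y : Matrix (Fin n) (Fin n) ℂ) (k : Fin n) :
    ((∑ i, ‖Y i k‖ ^ 2 : ℝ) : ℂ) = (Yᴴ * Y) k k := by
  rw [Matrix.mul_apply]
  push_cast
  refine Finset.sum_congr rfl fun i _ => ?_
  rw [conjTranspose_apply, Complex.star_def, Complex.conj_mul']

lemma alt_cs (E Y : Matrix (Fin n) (Fin n) ℂ) (k : Fin n) (hE : ∑ i, ‖E i k‖ ^ 2 ≤ 1) :
    ‖(Eᴴ * Y) k k‖ ≤ Real.sqrt (∑ i, ‖Y i k‖ ^ 2) := by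
  rw [Matrix.mul_apply]
  calc _ ≤ ∑ i, ‖E i k‖ * ‖Y i k‖ := by
        refine (norm_sum_le _ _).trans (le_of_eq ?_)
        refine Finset.sum_congr rfl fun i _ => ?_
        rw [norm_mul, conjTranspose_apply, norm_star]
    _ ≤ _ := by
        refine Real.le_sqrt_of_sq_le ((Finset.sum_mul_sq_le_sq_mul_sq _ _ _).trans ?_)
        exact mul_le_of_le_one_left (by positivity) hE

lemma altGood_SP (U V : unitaryGroup (Fin n) ℂ) (L R : Matrix (Fin n) (Fin n) ℂ) {d e : Fin n → ℂ → ℂ}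
    (hd : ∀ i, altGood (d i)) (he : ∀ i, altGood (e i)) (k : Fin n) :
    altGood (fun z => (L * (altSP V (fun i => e i z) * altSP U (fun i => d i z) * R)) k k) := by
  have hSP : ∀ (U : unitaryGroup (Fin n) ℂ) {d : Fin n → ℂ → ℂ}, (∀ i, altGood (d i)) →
      ∀ i j, altGood (fun z => altSP U (fun i => d i z) i j) := by
    intro U d hd i j
    unfold altSP
    simp only [Matrix.mul_apply (M := _ * _), Matrix.mul_diagonal]
    exact altGood_sum _ fun l => altGood_mul (altGood_mul (altGood_const _) (hd l)) (altGood_const _)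
  simp only [Matrix.mul_apply]
  exact altGood_sum _ fun l => altGood_mul (altGood_const _) (altGood_sum _ fun p =>
    altGood_mul (altGood_sum _ fun q => altGood_mul (hSP V he _ _) (hSP U hd _ _)) (altGood_const _))

lemma alt_trace_SP (U : unitaryGroup (Fin n) ℂ) (d : Fin n → ℂ) : trace (altSP U d) = ∑ i, d i := by
  unfold altSP
  rw [trace_mul_comm, ← Matrix.mul_assoc, altU, Matrix.one_mul, trace_diagonal]

/-- the interpolation step -/
lemma alt_three {f : ℂ → ℂ} (hf : altGood f) {a b θ : ℝ} (h0 : 0 ≤ θ) (h1 : θ ≤ 1)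
    (ha : ∀ z : ℂ, z.re = 0 → ‖f z‖ ≤ a) (hb : ∀ z : ℂ, z.re = 1 → ‖f z‖ ≤ b) :
    ‖f θ‖ ≤ a ^ (1 - θ) * b ^ θ := by
  obtain ⟨hd, K, hK⟩ := hf
  have := Complex.HadamardThreeLines.norm_le_interp_of_mem_verticalClosedStrip' (f := f) (z := θ)
    (a := a) (b := b) (l := 0) (u := 1) zero_lt_one ⟨by simpa using h0, by simpa using h1⟩
    hd.diffContOnCl ?_ (fun z hz => ha z hz) (fun z hz => hb z hz)
  · simpa using this
  · refine ⟨K, ?_⟩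
    rintro _ ⟨z, hz, rfl⟩
    exact hK z hz.1 hz.2

lemma alt_final {T N θ : ℝ} (hT : 0 < T) (hN : 0 ≤ N) (hθ : 0 < θ)
    (h : T ≤ T ^ (1 - θ) * (Real.sqrt T * Real.sqrt N) ^ θ) : T ≤ N := by
  have h1 : T ^ θ ≤ (Real.sqrt T * Real.sqrt N) ^ θ := by
    have e : T = T ^ (1 - θ) * T ^ θ := by
      rw [← Real.rpow_add hT]; simp
    have hp : 0 < T ^ (1 - θ) := Real.rpow_pos_of_pos hT _
    refine le_of_mul_le_mul_left ?_ hp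
    rw [← e]; exact h
  have h2 := (Real.rpow_le_rpow_iff hT.le (by positivity) hθ).1 h1
  have hs : 0 < Real.sqrt T := Real.sqrt_pos.2 hT
  have h3 : Real.sqrt T ≤ Real.sqrt N := by
    have := Real.mul_self_sqrt hT.le
    nlinarith
  exact (Real.sqrt_le_sqrt_iff hN).1 h3

lemma alt_main (A B : Matrix (Fin n) (Fin n) ℂ)
    (hA : A.PosSemidef) (hB : B.PosSemidef)
    (r : ℝ) (hr : 1 ≤ r) :
    (Matrix.trace (mpow (mpow A (1/2) * B * mpow A (1/2)) r)).re ≤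
      (Matrix.trace (mpow A (r/2) * mpow B r * mpow A (r/2))).re := by
  have hr0 : 0 < r := by linarith
  set X := mpow B (1/2) * mpow A (1/2) with hX
  set U := hA.1.eigenvectorUnitary with hU
  set a := hA.1.eigenvalues with ha
  set V := hB.1.eigenvectorUnitary with hV
  set b := hB.1.eigenvalues with hb
  have ha0 : ∀ i, 0 ≤ a i := hA.eigenvalues_nonneg
  have hb0 : ∀ i, 0 ≤ b i := hB.eigenvalues_nonneg
  have hBB : (mpow B (1/2))ᴴ * mpow B (1/2) = B := by
    conv_rhs => rw [alt_spec hB.1]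
    rw [alt_mpow hB.1, altSP_star, altSP_mul]
    congr 1
    funext i
    change (starRingEnd ℂ) ((b i ^ (1/2 : ℝ) : ℝ) : ℂ) * ((b i ^ (1/2 : ℝ) : ℝ) : ℂ) = ((b i : ℝ) : ℂ)
    rw [Complex.conj_ofReal, ← Complex.ofReal_mul, ← Real.rpow_add_of_nonneg (hb0 i)] <;> norm_num
  have hAs : (mpow A (1/2))ᴴ = mpow A (1/2) := by
    rw [alt_mpow hA.1, altSP_star]
    simp
  have hM : mpow A (1/2) * B * mpow A (1/2) = Xᴴ * X := by
    rw [hX, conjTranspose_mul, hAs]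
    nth_rewrite 1 [← hBB]
    simp only [Matrix.mul_assoc]
  rw [hM]
  have hP : (Xᴴ * X).PosSemidef := posSemidef_conjTranspose_mul_self X
  set W := hP.1.eigenvectorUnitary with hW
  set m := hP.1.eigenvalues with hm
  have hm0 : ∀ i, 0 ≤ m i := hP.eigenvalues_nonneg
  set Wm : Matrix (Fin n) (Fin n) ℂ := (W : Matrix (Fin n) (Fin n) ℂ) with hWm
  have hdiag : Wmᴴ * (Xᴴ * X) * Wm = diagonal (fun i => ((m i : ℝ) : ℂ)) := by
    have e := alt_spec hP.1
    rw [e]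
    unfold altSP
    calc _ = (Wmᴴ * Wm) * diagonal (fun i => ((m i : ℝ) : ℂ)) * (Wmᴴ * Wm) := by
          simp only [Matrix.mul_assoc]; rfl
      _ = _ := by rw [altU W]; simp
  -- traces
  have hT : (trace (mpow (Xᴴ * X) r)).re = ∑ i, m i ^ r := by
    rw [alt_mpow hP.1, alt_trace_SP]
    simp [hm]
  rw [hT]
  set T := ∑ i, m i ^ r with hTdef
  have hTnn : 0 ≤ T := Finset.sum_nonneg fun i _ => Real.rpow_nonneg (hm0 i) _
  have hAr : mpow A (r/2) * mpow A (r/2) = mpow A r := by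
    rw [alt_mpow hA.1, alt_mpow hA.1, altSP_mul]
    congr 1
    funext i
    rw [← Complex.ofReal_mul, ← Real.rpow_add_of_nonneg (ha0 i) (by positivity) (by positivity),
      add_halves]
  have hN : trace (mpow A (r/2) * mpow B r * mpow A (r/2)) = trace (mpow B r * mpow A r) := by
    rw [Matrix.mul_assoc, trace_mul_comm, Matrix.mul_assoc, hAr]
  rw [hN]
  -- the analytic family
  let Q : ℂ → Matrix (Fin n) (Fin n) ℂ := fun z =>
    altSP V (fun i => altCp (b i) ((0:ℝ) + z * (r/2 : ℝ))) * altSP U (fun i => altCp (a i) ((0:ℝ) + z * (r/2 : ℝ)))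
  let c : Fin n → ℝ := fun k => m k ^ (-(1/2) : ℝ)
  let E : Matrix (Fin n) (Fin n) ℂ := X * Wm * diagonal (fun k => ((c k : ℝ) : ℂ))
  have hcstar : (diagonal (fun k => ((c k : ℝ) : ℂ)))ᴴ = diagonal (fun k => ((c k : ℝ) : ℂ)) := by
    rw [diagonal_conjTranspose]; congr 1; funext i; simp
  have hEH : Eᴴ * (X * Wm) = diagonal (fun k => ((c k * m k : ℝ) : ℂ)) := by
    calc _ = diagonal (fun k => ((c k : ℝ) : ℂ)) * (Wmᴴ * (Xᴴ * X) * Wm) := by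
          simp only [E]
          rw [conjTranspose_mul, conjTranspose_mul, hcstar]
          simp only [Matrix.mul_assoc]
      _ = _ := by rw [hdiag, diagonal_mul_diagonal]; simp
  have hEE : Eᴴ * E = diagonal (fun k => ((c k * m k * c k : ℝ) : ℂ)) := by
    have : Eᴴ * E = Eᴴ * (X * Wm) * diagonal (fun k => ((c k : ℝ) : ℂ)) := by
      simp only [E, Matrix.mul_assoc]
    rw [this, hEH, diagonal_mul_diagonal]; simp
  have hE1 : ∀ k, ∑ i, ‖E i k‖ ^ 2 ≤ 1 := by
    intro k
    have h := alt_sum_col E k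
    rw [hEE, diagonal_apply_eq] at h
    rw [Complex.ofReal_injective h]
    rcases (hm0 k).eq_or_lt with h0 | h0
    · rw [← h0]; simp
    · have : c k * m k * c k = m k ^ (-(1/2) + 1 + -(1/2) : ℝ) := by
        simp only [c]
        rw [Real.rpow_add h0, Real.rpow_add h0, Real.rpow_one]
      rw [this]; norm_num
  let G : ℂ → ℂ := fun z => ∑ k, altCp (m k) ((r:ℝ) + z * (-(r/2) : ℝ)) * (Eᴴ * (Q z * Wm)) k k
  have hG : altGood G := altGood_sum _ fun k => altGood_mul (altGood_cp _ _ _)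
    (altGood_SP U V _ _ (fun i => altGood_cp _ _ _) (fun i => altGood_cp _ _ _) k)
  have hGb : ∀ z, ‖G z‖ ≤ ∑ k, ‖altCp (m k) ((r:ℝ) + z * (-(r/2) : ℝ))‖ *
      Real.sqrt (∑ i, ‖(Q z * Wm) i k‖ ^ 2) := by
    intro z
    refine (norm_sum_le _ _).trans (Finset.sum_le_sum fun k _ => ?_)
    rw [norm_mul]
    exact mul_le_mul_of_nonneg_left (alt_cs _ _ _ (hE1 k)) (norm_nonneg _)
  have h0 : ∀ z : ℂ, z.re = 0 → ‖G z‖ ≤ T := by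
    intro z hz
    refine (hGb z).trans (Finset.sum_le_sum fun k _ => ?_)
    have hone : ∀ (x : ℝ), 0 ≤ x → ‖altCp x ((0:ℝ) + z * (r/2 : ℝ))‖ ≤ 1 := by
      intro x hx
      rw [altCp_norm hx]
      split_ifs
      · exact zero_le_one
      · simp [hz]
    have h1 : Real.sqrt (∑ i, ‖(Q z * Wm) i k‖ ^ 2) ≤ 1 := by
      refine Real.sqrt_le_one.2 ?_
      exact alt_contr U V W _ _ (fun i => hone _ (ha0 i)) (fun i => hone _ (hb0 i)) k
    refine (mul_le_of_le_one_right (norm_nonneg _) h1).trans ?_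
    rw [altCp_norm (hm0 k)]
    split_ifs
    · exact Real.rpow_nonneg (hm0 k) _
    · simp [hz]
  have hF : ∀ z : ℂ, z.re = 1 → ∑ k, ∑ i, ‖(Q z * Wm) i k‖ ^ 2 = (trace (mpow B r * mpow A r)).re := by
    intro z hz
    have e1 : ((∑ k, ∑ i, ‖(Q z * Wm) i k‖ ^ 2 : ℝ) : ℂ) = trace ((Q z * Wm)ᴴ * (Q z * Wm)) := by
      rw [Complex.ofReal_sum, trace]
      exact Finset.sum_congr rfl fun k _ => alt_sum_col _ k
    have hre : ((0:ℝ) + z * (r/2 : ℝ) : ℂ).re = r / 2 := by simp [hz]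
    have eB : (altSP V (fun i => altCp (b i) ((0:ℝ) + z * (r/2 : ℝ))))ᴴ *
        altSP V (fun i => altCp (b i) ((0:ℝ) + z * (r/2 : ℝ))) = mpow B r := by
      rw [altSP_star, altSP_mul, alt_mpow hB.1]
      congr 1
      funext i
      exact altCp_star_mul (hb0 i) hr0.ne' hre
    have eA : altSP U (fun i => altCp (a i) ((0:ℝ) + z * (r/2 : ℝ))) *
        (altSP U (fun i => altCp (a i) ((0:ℝ) + z * (r/2 : ℝ))))ᴴ = mpow A r := by
      rw [altSP_star, altSP_mul, alt_mpow hA.1]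
      congr 1
      funext i
      rw [mul_comm]
      exact altCp_star_mul (ha0 i) hr0.ne' hre
    have e2 : trace ((Q z * Wm)ᴴ * (Q z * Wm)) = trace (mpow B r * mpow A r) := by
      rw [trace_mul_comm, conjTranspose_mul]
      have : Q z * Wm * (Wmᴴ * (Q z)ᴴ) = Q z * (Wm * Wmᴴ) * (Q z)ᴴ := by
        simp only [Matrix.mul_assoc]
      rw [this, altU' W, Matrix.mul_one]
      simp only [Q]
      rw [conjTranspose_mul, Matrix.mul_assoc, ← Matrix.mul_assoc (altSP U _) _ _, eA,
        trace_mul_comm, Matrix.mul_assoc, eB, trace_mul_comm]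
    rw [← e2, ← e1, Complex.ofReal_re]
  set N := (trace (mpow B r * mpow A r)).re with hNdef
  have hNnn : 0 ≤ N := by
    rw [← hF 1 (by simp)]; positivity
  have h1 : ∀ z : ℂ, z.re = 1 → ‖G z‖ ≤ Real.sqrt T * Real.sqrt N := by
    intro z hz
    refine (hGb z).trans ((Real.sum_mul_le_sqrt_mul_sqrt _ _ _).trans (le_of_eq ?_))
    congr 2
    · refine Finset.sum_congr rfl fun k _ => ?_
      have hre : ((r:ℝ) + z * (-(r/2) : ℝ) : ℂ).re = r / 2 := by simp [hz]; ring
      have := altCp_star_mul (hm0 k) hr0.ne' hre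
      rw [Complex.star_def, Complex.conj_mul'] at this
      exact_mod_cast this
    · rw [← hF z hz]
      exact Finset.sum_congr rfl fun k _ => Real.sq_sqrt (by positivity)
  have hθ : G ((1 / r : ℝ) : ℂ) = (T : ℂ) := by
    have e0 : ((0:ℝ) + ((1 / r : ℝ) : ℂ) * (r/2 : ℝ) : ℂ) = ((1/2 : ℝ) : ℂ) := by
      rw [← Complex.ofReal_mul, ← Complex.ofReal_add]; congr 1; field_simp; simp
    have e0' : ((r:ℝ) + ((1 / r : ℝ) : ℂ) * (-(r/2) : ℝ) : ℂ) = ((r - 1/2 : ℝ) : ℂ) := by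
      rw [← Complex.ofReal_mul, ← Complex.ofReal_add]; congr 1; field_simp; ring
    have eQ : Q ((1 / r : ℝ) : ℂ) = X := by
      simp only [Q]
      rw [e0, hX, alt_mpow hB.1, alt_mpow hA.1]
      congr 2 <;> funext i
      · exact altCp_ofReal (hb0 i) (by norm_num)
      · exact altCp_ofReal (ha0 i) (by norm_num)
    simp only [G]
    rw [eQ, e0', hEH, hTdef, Complex.ofReal_sum]
    refine Finset.sum_congr rfl fun k _ => ?_
    rw [diagonal_apply_eq, altCp_ofReal (hm0 k) (by linarith), ← Complex.ofReal_mul]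
    congr 1
    rcases (hm0 k).eq_or_lt with h0 | h0
    · rw [← h0]; simp [Real.zero_rpow hr0.ne']
    · simp only [c]
      nth_rewrite 3 [← Real.rpow_one (m k)]
      rw [← Real.rpow_add h0, ← Real.rpow_add h0]
      congr 1; ring
  have key := alt_three hG (θ := 1 / r) (by positivity) (by rw [div_le_one hr0]; exact hr) h0 h1
  rw [hθ, Complex.norm_real, Real.norm_of_nonneg hTnn] at key
  rcases hTnn.eq_or_lt with h | h
  · rw [← h]; exact hNnn
  · exact alt_final h hNnn (by positivity) key

end

/-- Araki–Lieb–Thirring trace inequality (direct direction): for `A, B` positive semidefinite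
and `r ≥ 1`: `Tr[(A^{1/2} B A^{1/2})^r] ≤ Tr[A^{r/2} B^r A^{r/2}]`. -/
theorem stmt_9 {n : ℕ} (A B : Matrix (Fin n) (Fin n) ℂ)
    (hA : A.PosSemidef) (hB : B.PosSemidef)
    (r : ℝ) (hr : 1 ≤ r) :
    (Matrix.trace (mpow (mpow A (1/2) * B * mpow A (1/2)) r)).re ≤
      (Matrix.trace (mpow A (r/2) * mpow B r * mpow A (r/2))).re := by
  exact alt_main A B hA hB r hr
end

section
/- (Araki–Lieb–Thirring trace inequality, reversed direction.) Let A and B be n×n complex positive semidefinite matrices. Then for every real r ∈ [0,1]: Tr[A^{r/2} · B^r · A^{r/2}] ≤ Tr[(A^{1/2} B A^{1/2})^r]. -/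
open scoped ComplexOrder

open Matrix in
theorem res_ineq {n : ℕ} (W E : Matrix (Fin n) (Fin n) ℂ) (hW : W * Wᴴ = 1) (hE : E * Eᴴ = 1)
    (d b c : Fin n → ℝ) (hd : ∀ i, 0 < d i) (hb : ∀ i, 0 ≤ b i) (hc : ∀ i, 0 < c i)
    (h : diagonal (fun i => (d i : ℂ)) + W * diagonal (fun i => (b i : ℂ)) * Wᴴ
      = E * diagonal (fun i => (c i : ℂ)) * Eᴴ) :
    ∑ k, 1 / c k ≤ ∑ i, ∑ j, ‖W i j‖ ^ 2 / (d i + b j) := by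
  have hE' : Eᴴ * E = 1 := mul_eq_one_comm.mp hE
  set Z : Matrix (Fin n) (Fin n) ℂ := E * diagonal (fun i => ((1 / c i : ℝ) : ℂ)) * Eᴴ with hZ
  have hcc : diagonal (fun i => (c i : ℂ)) * diagonal (fun i => ((1 / c i : ℝ) : ℂ)) = 1 := by
    rw [diagonal_mul_diagonal, ← diagonal_one]
    congr 1; funext i
    have := (hc i).ne'
    have h' : (c i : ℂ) ≠ 0 := by exact_mod_cast this
    push_cast
    rw [mul_one_div_cancel h']
  have hMZ : (diagonal (fun i => (d i : ℂ)) + W * diagonal (fun i => (b i : ℂ)) * Wᴴ) * Z = 1 := by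
    rw [h, hZ]
    calc _ = E * (diagonal (fun i => (c i : ℂ)) * ((Eᴴ * E) * diagonal (fun i => ((1 / c i : ℝ) : ℂ)))) * Eᴴ := by
          simp only [Matrix.mul_assoc]
      _ = 1 := by rw [hE', Matrix.one_mul, hcc, Matrix.mul_one, hE]
  have hZH : Zᴴ = Z := by
    rw [hZ]
    simp only [conjTranspose_mul, conjTranspose_conjTranspose, diagonal_conjTranspose, Matrix.mul_assoc]
    congr 3
    ext i
    simp
  have hT : Z.trace = ((∑ k, 1 / c k : ℝ) : ℂ) := by
    rw [hZ, Matrix.trace_mul_comm, ← Matrix.mul_assoc, hE', Matrix.one_mul, trace_diagonal]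
    push_cast; rfl
  clear_value Z
  obtain ⟨X, hX⟩ : ∃ X, X = Z * W := ⟨_, rfl⟩
  have h1 : Z.trace = ∑ i, ∑ j, X i j * star (W i j) := by
    have : Z = X * Wᴴ := by rw [hX, Matrix.mul_assoc, hW, Matrix.mul_one]
    conv_lhs => rw [this]
    simp [Matrix.trace, Matrix.mul_apply, conjTranspose_apply]
  have hXX : X * Xᴴ = Z * Z := by
    rw [hX, conjTranspose_mul, hZH, ← Matrix.mul_assoc, Matrix.mul_assoc Z W, hW, Matrix.mul_one]
  have h2 : Z.trace = ∑ i, ∑ j, ((d i : ℂ) + b j) * (X i j * star (X i j)) := by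
    have e1 : Z = Z * ((diagonal (fun i => (d i : ℂ)) + W * diagonal (fun i => (b i : ℂ)) * Wᴴ) * Z) := by
      rw [hMZ, Matrix.mul_one]
    have e2 : Z.trace = (diagonal (fun i => (d i : ℂ)) * (X * Xᴴ)).trace
        + (X * diagonal (fun i => (b i : ℂ)) * Xᴴ).trace := by
      conv_lhs => rw [e1]
      rw [Matrix.add_mul, Matrix.mul_add, trace_add]
      congr 1
      · rw [hXX, Matrix.trace_mul_comm, Matrix.mul_assoc]
      · rw [hX, conjTranspose_mul, hZH]; simp only [Matrix.mul_assoc]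
    rw [e2]
    simp only [Matrix.trace, Matrix.diag, Matrix.mul_assoc]
    simp only [Matrix.diagonal_mul, Matrix.mul_apply (M := X), conjTranspose_apply, Finset.mul_sum,
      ← Finset.sum_add_distrib]
    refine Finset.sum_congr rfl fun i _ => Finset.sum_congr rfl fun j _ => ?_
    ring
  have r1 : (∑ k, 1 / c k) = ∑ i, ∑ j, (X i j * star (W i j)).re := by
    have := congrArg Complex.re (hT.symm.trans h1)
    simpa only [Complex.ofReal_re, Complex.re_sum] using this
  have r2 : (∑ k, 1 / c k) = ∑ i, ∑ j, (d i + b j) * ‖X i j‖ ^ 2 := by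
    have := congrArg Complex.re (hT.symm.trans h2)
    simp only [Complex.ofReal_re, Complex.re_sum] at this
    rw [this]
    refine Finset.sum_congr rfl fun i _ => Finset.sum_congr rfl fun j _ => ?_
    have : X i j * star (X i j) = ((‖X i j‖ ^ 2 : ℝ) : ℂ) := by
      rw [← starRingEnd_apply, Complex.mul_conj, Complex.normSq_eq_norm_sq]
    rw [this, ← Complex.ofReal_add, ← Complex.ofReal_mul, Complex.ofReal_re]
  have : (∑ k, 1 / c k) = ∑ i, ∑ j, (2 * (X i j * star (W i j)).re - (d i + b j) * ‖X i j‖ ^ 2) := by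
    simp only [Finset.sum_sub_distrib, ← Finset.mul_sum]
    rw [← r1]
    simp only [Finset.mul_sum]
    rw [← r2, ← Finset.mul_sum]; ring
  rw [this]
  refine Finset.sum_le_sum fun i _ => Finset.sum_le_sum fun j _ => ?_
  have hm : 0 < d i + b j := add_pos_of_pos_of_nonneg (hd i) (hb j)
  have h3 : (X i j * star (W i j)).re ≤ ‖X i j‖ * ‖W i j‖ := by
    refine (Complex.re_le_norm _).trans ?_
    rw [norm_mul, norm_star]
  rw [le_div_iff₀ hm]
  nlinarith [sq_nonneg ((d i + b j) * ‖X i j‖ - ‖W i j‖), mul_le_mul_of_nonneg_left h3 hm.le]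

/-- scalar step -/
theorem log_step {κ ι : Type*} [Fintype κ] [Fintype ι] (c : κ → ℝ) (w m : ι → ℝ)
    (hc : ∀ k, 0 < c k) (hm : ∀ i, 0 < m i) (hw : ∑ i, w i = Fintype.card κ)
    (h : ∀ s : ℝ, 0 ≤ s → ∑ k, 1 / (c k + s) ≤ ∑ i, w i / (m i + s)) :
    ∑ i, w i * Real.log (m i) ≤ ∑ k, Real.log (c k) := by
  set G : ℝ → ℝ := fun s => ∑ k, Real.log (c k + s) - ∑ i, w i * Real.log (m i + s) with hG
  have hder : ∀ s : ℝ, 0 ≤ s →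
      HasDerivAt G (∑ k, 1 / (c k + s) - ∑ i, w i * (1 / (m i + s))) s := by
    intro s hs
    refine HasDerivAt.sub (HasDerivAt.fun_sum fun k _ => ?_) (HasDerivAt.fun_sum fun i _ => ?_)
    · exact ((hasDerivAt_id s).const_add (c k)).log (by have := hc k; simp; linarith)
    · exact (((hasDerivAt_id s).const_add (m i)).log (by have := hm i; simp; linarith)).const_mul _
  have hanti : AntitoneOn G (Set.Ici 0) := by
    refine antitoneOn_of_deriv_nonpos (convex_Ici 0)
      (fun s hs => (hder s hs).continuousAt.continuousWithinAt) ?_ ?_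
    · intro s hs
      rw [interior_Ici] at hs
      exact (hder s (le_of_lt hs)).differentiableAt.differentiableWithinAt
    · intro s hs
      rw [interior_Ici] at hs
      rw [(hder s (le_of_lt hs)).deriv]
      have := h s (le_of_lt hs)
      simp only [mul_one_div]
      linarith
  have hlim1 : ∀ x : ℝ, Filter.Tendsto (fun s => Real.log (x + s) - Real.log s) Filter.atTop (nhds 0) := by
    intro x
    have h1 : Filter.Tendsto (fun s : ℝ => Real.log (x / s + 1)) Filter.atTop (nhds (Real.log (0 + 1))) := by
      refine Filter.Tendsto.log ?_ (by norm_num)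
      exact (Filter.Tendsto.div_atTop tendsto_const_nhds Filter.tendsto_id).add_const 1
    simp only [zero_add, Real.log_one] at h1
    refine h1.congr' ?_
    filter_upwards [Filter.eventually_gt_atTop 0, Filter.eventually_gt_atTop (-x)] with s h0 hx
    rw [← Real.log_div (by linarith) h0.ne']
    congr 1; field_simp
  have hlim : Filter.Tendsto G Filter.atTop (nhds 0) := by
    have : G = fun s => ∑ k, (Real.log (c k + s) - Real.log s)
        - ∑ i, w i * (Real.log (m i + s) - Real.log s) := by
      funext s
      simp only [hG, mul_sub, Finset.sum_sub_distrib, ← Finset.sum_mul, hw]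
      simp
    rw [this]
    have := (tendsto_finsetSum (Finset.univ) fun k _ => hlim1 (c k)).sub
      (tendsto_finsetSum (Finset.univ) fun i _ => (hlim1 (m i)).const_mul (w i))
    simpa using this
  have : 0 ≤ G 0 := by
    refine le_of_tendsto hlim ?_
    filter_upwards [Filter.eventually_ge_atTop 0] with s hs
    exact hanti (Set.mem_Ici.mpr le_rfl) hs hs
  simp only [hG, add_zero] at this
  linarith

open MeasureTheory in
theorem rpow_step {κ ι : Type*} [Fintype κ] [Fintype ι] (c : κ → ℝ) (w x : ι → ℝ)
    (hc : ∀ k, 0 ≤ c k) (hx : ∀ i, 0 ≤ x i) (r : ℝ) (hr0 : 0 < r) (hr1 : r < 1)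
    (h : ∀ t : ℝ, 0 < t → ∑ i, w i * Real.log (1 + t * x i) ≤ ∑ k, Real.log (1 + t * c k)) :
    ∑ i, w i * x i ^ r ≤ ∑ k, c k ^ r := by
  set g : ℝ → ℝ := fun t => t ^ (-r - 1) * Real.log (1 + t) with hg
  have hgpos : ∀ t, 0 < t → 0 < g t := fun t ht =>
    mul_pos (Real.rpow_pos_of_pos ht _) (Real.log_pos (by linarith))
  have hcont : ContinuousOn g (Set.Ioi 0) := by
    intro t ht
    have ht : 0 < t := ht
    refine ContinuousAt.continuousWithinAt ?_
    refine ContinuousAt.mul (Real.continuousAt_rpow_const _ _ (Or.inl ht.ne')) ?_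
    exact ContinuousAt.log (by fun_prop) (by linarith)
  have hint : IntegrableOn g (Set.Ioi 0) := by
    rw [← Set.Ioc_union_Ioi_eq_Ioi (zero_le_one' ℝ)]
    refine IntegrableOn.union ?_ ?_
    · have h1 : IntegrableOn (fun t : ℝ => t ^ (-r)) (Set.Ioc 0 1) :=
        (intervalIntegrable_iff_integrableOn_Ioc_of_le zero_le_one).mp
          (intervalIntegral.intervalIntegrable_rpow' (by linarith))
      refine Integrable.mono' h1
        ((hcont.mono Set.Ioc_subset_Ioi_self).aestronglyMeasurable measurableSet_Ioc) ?_
      filter_upwards [ae_restrict_mem measurableSet_Ioc] with t ht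
      rw [Real.norm_of_nonneg (hgpos t ht.1).le]
      calc g t ≤ t ^ (-r - 1) * t := by
            refine mul_le_mul_of_nonneg_left ?_ (Real.rpow_nonneg ht.1.le _)
            have := Real.log_le_sub_one_of_pos (show 0 < 1 + t by linarith [ht.1])
            linarith
        _ = t ^ (-r) := by
            rw [← Real.rpow_add_one ht.1.ne']; congr 1; ring
    · have h1 : IntegrableOn (fun t : ℝ => (2 ^ (r / 2) / (r / 2)) * t ^ (-r / 2 - 1)) (Set.Ioi 1) :=
        (integrableOn_Ioi_rpow_of_lt (by linarith) zero_lt_one).const_mul _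
      refine Integrable.mono' h1
        ((hcont.mono (Set.Ioi_subset_Ioi zero_le_one)).aestronglyMeasurable measurableSet_Ioi) ?_
      filter_upwards [ae_restrict_mem measurableSet_Ioi] with t ht
      have ht : 1 < t := ht
      have ht0 : 0 < t := by linarith
      rw [Real.norm_of_nonneg (hgpos t ht0).le]
      calc g t ≤ t ^ (-r - 1) * ((2 * t) ^ (r / 2) / (r / 2)) := by
            refine mul_le_mul_of_nonneg_left ?_ (Real.rpow_nonneg ht0.le _)
            refine (Real.log_le_rpow_div (by linarith) (half_pos hr0)).trans ?_
            gcongr; linarith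
        _ = _ := by
            rw [Real.mul_rpow (by norm_num) ht0.le,
              show -r / 2 - 1 = (-r - 1) + r / 2 by ring, Real.rpow_add ht0]
            ring
  set K := ∫ t in Set.Ioi (0 : ℝ), g t with hK
  have hKpos : 0 < K := by
    rw [hK, setIntegral_pos_iff_support_of_nonneg_ae]
    · have : Function.support g ∩ Set.Ioi 0 = Set.Ioi 0 := by
        ext t; simp only [Set.mem_inter_iff, Function.mem_support, Set.mem_Ioi]
        exact ⟨fun h => h.2, fun h => ⟨(hgpos t h).ne', h⟩⟩
      rw [this]; simp
    · filter_upwards [ae_restrict_mem measurableSet_Ioi] with t ht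
      exact (hgpos t ht).le
    · exact hint
  have key : ∀ y : ℝ, 0 ≤ y →
      IntegrableOn (fun t => t ^ (-r - 1) * Real.log (1 + t * y)) (Set.Ioi 0) ∧
      ∫ t in Set.Ioi (0 : ℝ), t ^ (-r - 1) * Real.log (1 + t * y) = y ^ r * K := by
    intro y hy
    rcases hy.eq_or_lt with rfl | hy
    · simp [Real.zero_rpow hr0.ne']
    have e : Set.EqOn (fun t => y ^ (r + 1) * g (y * t))
        (fun t => t ^ (-r - 1) * Real.log (1 + t * y)) (Set.Ioi 0) := by
      intro t ht
      have ht : 0 < t := ht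
      simp only [hg]
      rw [Real.mul_rpow hy.le ht.le, mul_comm y t, ← mul_assoc, ← mul_assoc, ← Real.rpow_add hy]
      simp
    constructor
    · refine IntegrableOn.congr_fun ?_ e measurableSet_Ioi
      refine Integrable.const_mul ?_ _
      have := (integrableOn_Ioi_comp_mul_left_iff g 0 hy).mpr (by simpa using hint)
      exact this
    · rw [← setIntegral_congr_fun measurableSet_Ioi e, integral_const_mul,
        integral_comp_mul_left_Ioi g 0 hy, mul_zero, ← hK, smul_eq_mul, Real.rpow_add_one hy.ne']
      field_simp
  have i1 : ∫ t in Set.Ioi (0 : ℝ), ∑ i, w i * (t ^ (-r - 1) * Real.log (1 + t * x i))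
      = (∑ i, w i * x i ^ r) * K := by
    rw [integral_finsetSum _ fun i _ => ((key _ (hx i)).1.const_mul (w i)), Finset.sum_mul]
    refine Finset.sum_congr rfl fun i _ => ?_
    rw [integral_const_mul, (key _ (hx i)).2]; ring
  have i2 : ∫ t in Set.Ioi (0 : ℝ), ∑ k, (t ^ (-r - 1) * Real.log (1 + t * c k))
      = (∑ k, c k ^ r) * K := by
    rw [integral_finsetSum _ fun i _ => ((key _ (hc i)).1), Finset.sum_mul]
    refine Finset.sum_congr rfl fun i _ => ?_
    rw [(key _ (hc i)).2]
  refine le_of_mul_le_mul_right ?_ hKpos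
  rw [← i1, ← i2]
  refine setIntegral_mono_on ?_ ?_ measurableSet_Ioi ?_
  · exact integrable_finsetSum _ fun i _ => ((key _ (hx i)).1.const_mul (w i))
  · exact integrable_finsetSum _ fun i _ => ((key _ (hc i)).1)
  · intro t ht
    have ht : 0 < t := ht
    have := mul_le_mul_of_nonneg_left (h t ht) (Real.rpow_nonneg ht.le (-r - 1))
    rw [Finset.mul_sum, Finset.mul_sum] at this
    refine le_trans (le_of_eq ?_) this
    exact Finset.sum_congr rfl fun i _ => by ring

open Matrix in
theorem spec_psd {n : ℕ} (A : Matrix (Fin n) (Fin n) ℂ) (hA : A.PosSemidef) :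
    ∃ (U : Matrix (Fin n) (Fin n) ℂ) (a : Fin n → ℝ), U * Uᴴ = 1 ∧ (∀ i, 0 ≤ a i) ∧
      A = U * diagonal (fun i => (a i : ℂ)) * Uᴴ ∧
      ∀ s, mpow A s = U * diagonal (fun i => ((a i ^ s : ℝ) : ℂ)) * Uᴴ := by
  refine ⟨hA.1.eigenvectorUnitary, hA.1.eigenvalues, ?_, hA.eigenvalues_nonneg, ?_, fun s => ?_⟩
  · exact Unitary.mul_star_self_of_mem hA.1.eigenvectorUnitary.2
  · exact hA.1.spectral_theorem
  · unfold mpow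
    rw [hA.1.cfc_eq]
    rfl

open Matrix in
theorem row_sum {n : ℕ} (W : Matrix (Fin n) (Fin n) ℂ) (hW : W * Wᴴ = 1) (i : Fin n) :
    ∑ j, ‖W i j‖ ^ 2 = 1 := by
  have h := congrFun (congrFun hW i) i
  simp only [Matrix.mul_apply, conjTranspose_apply, one_apply_eq] at h
  have h2 := congrArg Complex.re h
  rw [Complex.re_sum, Complex.one_re] at h2
  rw [← h2]
  refine Finset.sum_congr rfl fun j _ => ?_
  rw [← starRingEnd_apply, Complex.mul_conj, Complex.normSq_eq_norm_sq, Complex.ofReal_re]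

open Matrix in
theorem det_conj_diag {n : ℕ} (E : Matrix (Fin n) (Fin n) ℂ) (hE : E * Eᴴ = 1) (c : Fin n → ℝ) :
    (E * diagonal (fun i => (c i : ℂ)) * Eᴴ).det = ((∏ i, c i : ℝ) : ℂ) := by
  have hE' : Eᴴ * E = 1 := mul_eq_one_comm.mp hE
  rw [det_mul_comm, ← Matrix.mul_assoc, hE', Matrix.one_mul, det_diagonal]
  push_cast; rfl

open Matrix in
theorem det_log_pos {n : ℕ} (W : Matrix (Fin n) (Fin n) ℂ) (hW : W * Wᴴ = 1)
    (a b : Fin n → ℝ) (ha : ∀ i, 0 < a i) (hb : ∀ i, 0 ≤ b i) :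
    Real.exp (∑ i, ∑ j, ‖W i j‖ ^ 2 * Real.log (1 + a i * b j)) ≤
      (det (1 + diagonal (fun i => (a i : ℂ)) * (W * diagonal (fun i => (b i : ℂ)) * Wᴴ))).re := by
  have hd : ∀ i, 0 < (a i)⁻¹ := fun i => inv_pos.mpr (ha i)
  have hM : (diagonal (fun i => (((a i)⁻¹ : ℝ) : ℂ)) + W * diagonal (fun i => (b i : ℂ)) * Wᴴ).PosDef := by
    refine Matrix.PosDef.add_posSemidef ?_ ?_
    · rw [posDef_diagonal_iff]
      intro i
      exact_mod_cast hd i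
    · refine Matrix.PosSemidef.mul_mul_conjTranspose_same ?_ W
      rw [posSemidef_diagonal_iff]
      intro i
      exact_mod_cast hb i
  obtain ⟨E, c, hE, hc, h⟩ : ∃ (E : Matrix (Fin n) (Fin n) ℂ) (c : Fin n → ℝ), E * Eᴴ = 1 ∧
      (∀ i, 0 < c i) ∧ diagonal (fun i => (((a i)⁻¹ : ℝ) : ℂ)) + W * diagonal (fun i => (b i : ℂ)) * Wᴴ
        = E * diagonal (fun i => (c i : ℂ)) * Eᴴ :=
    ⟨hM.1.eigenvectorUnitary, hM.1.eigenvalues,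
      Unitary.mul_star_self_of_mem hM.1.eigenvectorUnitary.2, hM.eigenvalues_pos,
      hM.1.spectral_theorem⟩
  have key := log_step c (fun p : Fin n × Fin n => ‖W p.1 p.2‖ ^ 2) (fun p => (a p.1)⁻¹ + b p.2) hc
    (fun p => add_pos_of_pos_of_nonneg (hd _) (hb _))
    (by rw [Fintype.sum_prod_type]; simp [row_sum W hW]) (by
      intro s hs
      have hdiag : ∀ f : Fin n → ℝ, diagonal (fun i => ((f i + s : ℝ) : ℂ))
          = diagonal (fun i => (f i : ℂ)) + (s : ℂ) • (1 : Matrix (Fin n) (Fin n) ℂ) := by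
        intro f
        rw [smul_one_eq_diagonal, diagonal_add]
        simp
      have := res_ineq W E hW hE (fun i => (a i)⁻¹ + s) b (fun i => c i + s)
        (fun i => by have := hd i; linarith) hb (fun i => by have := hc i; linarith) (by
          rw [hdiag (fun i => (a i)⁻¹), hdiag c, add_right_comm, h, Matrix.mul_add, Matrix.add_mul]
          congr 1
          rw [Matrix.mul_smul, Matrix.mul_one, Matrix.smul_mul, hE])
      rw [Fintype.sum_prod_type]
      refine this.trans (le_of_eq ?_)
      refine Finset.sum_congr rfl fun i _ => Finset.sum_congr rfl fun j _ => ?_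
      rw [add_right_comm])
  rw [Fintype.sum_prod_type] at key
  have hdet : det (1 + diagonal (fun i => (a i : ℂ)) * (W * diagonal (fun i => (b i : ℂ)) * Wᴴ))
      = ((∏ i, a i * c i : ℝ) : ℂ) := by
    have e : (1 : Matrix (Fin n) (Fin n) ℂ) = diagonal (fun i => (a i : ℂ)) * diagonal (fun i => (((a i)⁻¹ : ℝ) : ℂ)) := by
      rw [diagonal_mul_diagonal, ← diagonal_one]
      congr 1; funext i
      rw [← Complex.ofReal_mul, mul_inv_cancel₀ (ha i).ne', Complex.ofReal_one]
    rw [e, ← Matrix.mul_add, h, det_mul, det_conj_diag E hE, det_diagonal, Finset.prod_mul_distrib]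
    push_cast; rfl
  rw [hdet, Complex.ofReal_re, ← Real.le_log_iff_exp_le (Finset.prod_pos fun i _ => mul_pos (ha i) (hc i)),
    Real.log_prod (fun i _ => (mul_pos (ha i) (hc i)).ne')]
  have e1 : ∀ i, Real.log (a i * c i) = Real.log (a i) + Real.log (c i) := fun i =>
    Real.log_mul (ha i).ne' (hc i).ne'
  have e2 : ∀ i j, ‖W i j‖ ^ 2 * Real.log (1 + a i * b j)
      = ‖W i j‖ ^ 2 * Real.log (a i) + ‖W i j‖ ^ 2 * Real.log ((a i)⁻¹ + b j) := by
    intro i j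
    rw [← mul_add, ← Real.log_mul (ha i).ne' (add_pos_of_pos_of_nonneg (hd _) (hb _)).ne', mul_add,
      mul_inv_cancel₀ (ha i).ne']
  simp only [e1, e2, Finset.sum_add_distrib, ← Finset.sum_mul, row_sum W hW, one_mul]
  linarith

open Matrix in
theorem det_log_nonneg {n : ℕ} (W : Matrix (Fin n) (Fin n) ℂ) (hW : W * Wᴴ = 1)
    (a b : Fin n → ℝ) (ha : ∀ i, 0 ≤ a i) (hb : ∀ i, 0 ≤ b i) :
    Real.exp (∑ i, ∑ j, ‖W i j‖ ^ 2 * Real.log (1 + a i * b j)) ≤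
      (det (1 + diagonal (fun i => (a i : ℂ)) * (W * diagonal (fun i => (b i : ℂ)) * Wᴴ))).re := by
  have hL : ContinuousAt (fun ε : ℝ =>
      Real.exp (∑ i, ∑ j, ‖W i j‖ ^ 2 * Real.log (1 + (a i + ε) * b j))) 0 := by
    refine ContinuousAt.rexp ?_
    refine tendsto_finsetSum _ fun i _ => tendsto_finsetSum _ fun j _ => ?_
    refine ContinuousAt.mul continuousAt_const (ContinuousAt.log (by fun_prop) ?_)
    have := mul_nonneg (ha i) (hb j)
    simp only [add_zero]
    linarith
  have hR : Continuous (fun ε : ℝ =>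
      (det (1 + diagonal (fun i => ((a i + ε : ℝ) : ℂ)) * (W * diagonal (fun i => (b i : ℂ)) * Wᴴ))).re) := by
    refine Complex.continuous_re.comp (Continuous.matrix_det ?_)
    refine continuous_const.add (Continuous.mul ?_ continuous_const)
    refine Continuous.matrix_diagonal ?_
    fun_prop
  have := le_of_tendsto_of_tendsto (b := nhdsWithin (0 : ℝ) (Set.Ioi 0))
    (hL.tendsto.mono_left nhdsWithin_le_nhds)
    ((hR.tendsto 0).mono_left nhdsWithin_le_nhds) (by
      filter_upwards [self_mem_nhdsWithin] with ε hε
      have hε : 0 < ε := hε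
      exact det_log_pos W hW (fun i => a i + ε) b (fun i => by have := ha i; linarith) hb)
  simpa only [add_zero] using this

open Matrix in
theorem stmt_10 {n : ℕ} (A B : Matrix (Fin n) (Fin n) ℂ)
    (hA : A.PosSemidef) (hB : B.PosSemidef)
    (r : ℝ) (hr : r ∈ Set.Icc (0 : ℝ) 1) :
    (Matrix.trace (mpow A (r/2) * mpow B r * mpow A (r/2))).re ≤
      (Matrix.trace (mpow (mpow A (1/2) * B * mpow A (1/2)) r)).re := by
  obtain ⟨U, a, hU, ha, hAU, hAs⟩ := spec_psd A hA
  obtain ⟨V, b, hV, hb, hBV, hBs⟩ := spec_psd B hB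
  have hU' : Uᴴ * U = 1 := mul_eq_one_comm.mp hU
  have hV' : Vᴴ * V = 1 := mul_eq_one_comm.mp hV
  have hsq : ∀ s : ℝ, 0 < s → mpow A (s / 2) * mpow A (s / 2) = mpow A s := by
    intro s hs
    rw [hAs, hAs]
    calc _ = U * (diagonal (fun i => ((a i ^ (s / 2) : ℝ) : ℂ)) * ((Uᴴ * U) *
          diagonal (fun i => ((a i ^ (s / 2) : ℝ) : ℂ)))) * Uᴴ := by simp only [Matrix.mul_assoc]
      _ = _ := by
        rw [hU', Matrix.one_mul, diagonal_mul_diagonal]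
        congr 3; funext i
        rw [← Complex.ofReal_mul, ← Real.rpow_add_of_nonneg (ha i) (by positivity) (by positivity),
          add_halves]
  have hherm : (mpow A (1/2))ᴴ = mpow A (1/2) := by
    rw [hAs]
    simp only [conjTranspose_mul, conjTranspose_conjTranspose, diagonal_conjTranspose, Matrix.mul_assoc]
    congr 3
    ext i
    simp
  have hC : (mpow A (1/2) * B * mpow A (1/2)).PosSemidef := by
    have := hB.mul_mul_conjTranspose_same (mpow A (1/2))
    rwa [hherm] at this
  obtain ⟨K, c, hK, hc, hCK, hCs⟩ := spec_psd _ hC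
  have hK' : Kᴴ * K = 1 := mul_eq_one_comm.mp hK
  have hA1 : mpow A 1 = A := by
    rw [hAs]; simp only [Real.rpow_one]; exact hAU.symm
  have htr : ∀ s, (mpow (mpow A (1/2) * B * mpow A (1/2)) s).trace = ((∑ k, c k ^ s : ℝ) : ℂ) := by
    intro s
    rw [hCs, Matrix.trace_mul_comm, ← Matrix.mul_assoc, hK', Matrix.one_mul, trace_diagonal]
    push_cast; rfl
  rcases hr.1.eq_or_lt with rfl | hr0
  · rw [htr]
    have h1 : ∀ (M : Matrix (Fin n) (Fin n) ℂ) (hM : M.PosSemidef), mpow M 0 = 1 := by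
      intro M hM
      obtain ⟨U, a, hU, -, -, h⟩ := spec_psd M hM
      rw [h]
      simp [hU]
    rw [zero_div, h1 A hA, h1 B hB]
    simp
  rcases hr.2.eq_or_lt with rfl | hr1
  · have h1 : ∀ (M : Matrix (Fin n) (Fin n) ℂ) (hM : M.PosSemidef), mpow M 1 = M := by
      intro M hM
      obtain ⟨U, a, hU, -, h', h⟩ := spec_psd M hM
      rw [h]
      simp only [Real.rpow_one]
      exact h'.symm
    rw [h1 B hB, h1 _ hC]
  rw [htr, Complex.ofReal_re]
  obtain ⟨W, hWdef⟩ : ∃ W, W = Uᴴ * V := ⟨_, rfl⟩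
  have hWH : Wᴴ = Vᴴ * U := by rw [hWdef, conjTranspose_mul, conjTranspose_conjTranspose]
  have hW : W * Wᴴ = 1 := by
    rw [hWH, hWdef]
    calc _ = Uᴴ * ((V * Vᴴ) * U) := by simp only [Matrix.mul_assoc]
      _ = 1 := by rw [hV, Matrix.one_mul, hU']
  have hlhs : (Matrix.trace (mpow A (r/2) * mpow B r * mpow A (r/2))).re
      = ∑ p : Fin n × Fin n, ‖W p.1 p.2‖ ^ 2 * (a p.1 * b p.2) ^ r := by
    have e : Matrix.trace (mpow A (r/2) * mpow B r * mpow A (r/2))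
        = Matrix.trace (diagonal (fun i => ((a i ^ r : ℝ) : ℂ)) *
          (W * (diagonal (fun i => ((b i ^ r : ℝ) : ℂ)) * Wᴴ))) := by
      rw [Matrix.trace_mul_comm, ← Matrix.mul_assoc, hsq r hr0, hAs, hBs, hWH, hWdef]
      simp only [Matrix.mul_assoc]
      rw [Matrix.trace_mul_comm]
      simp only [Matrix.mul_assoc]
    rw [e, Fintype.sum_prod_type]
    simp only [Matrix.trace, Matrix.diag, Matrix.diagonal_mul, Matrix.mul_apply (M := W),
      conjTranspose_apply, Finset.mul_sum, Complex.re_sum]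
    refine Finset.sum_congr rfl fun i _ => Finset.sum_congr rfl fun j _ => ?_
    have : ((a i ^ r : ℝ) : ℂ) * (W i j * (((b j ^ r : ℝ) : ℂ) * star (W i j)))
        = ((‖W i j‖ ^ 2 * (a i * b j) ^ r : ℝ) : ℂ) := by
      rw [Real.mul_rpow (ha i) (hb j), ← Complex.normSq_eq_norm_sq]
      rw [Complex.ofReal_mul, ← Complex.mul_conj, starRingEnd_apply]
      push_cast
      ring
    rw [this, Complex.ofReal_re]
  rw [hlhs]
  refine rpow_step c _ _ hc (fun p => mul_nonneg (ha _) (hb _)) r hr0 hr1 ?_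
  intro t ht
  have hpos : ∀ k, 0 < 1 + t * c k := fun k => by
    have := mul_nonneg ht.le (hc k)
    linarith
  have hdet1 : det (1 + (t : ℂ) • (mpow A (1/2) * B * mpow A (1/2)))
      = ((∏ k, (1 + t * c k) : ℝ) : ℂ) := by
    rw [← det_conj_diag K hK, hCK]
    congr 1
    have : diagonal (fun i => ((1 + t * c i : ℝ) : ℂ))
          = 1 + (t : ℂ) • diagonal (fun i => (c i : ℂ)) := by
      rw [← diagonal_smul, ← diagonal_one, diagonal_add]
      simp
    rw [this, Matrix.mul_add, Matrix.add_mul, Matrix.mul_one, hK, Matrix.mul_smul, Matrix.smul_mul]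
  have hdet2 : det (1 + (t : ℂ) • (mpow A (1/2) * B * mpow A (1/2)))
      = det (1 + diagonal (fun i => (a i : ℂ)) *
        (W * diagonal (fun i => ((t * b i : ℝ) : ℂ)) * Wᴴ)) := by
    have hd : diagonal (fun i => ((t * b i : ℝ) : ℂ)) = (t : ℂ) • diagonal (fun i => (b i : ℂ)) := by
      rw [← diagonal_smul]
      congr 1; funext i
      rw [Pi.smul_apply, smul_eq_mul, Complex.ofReal_mul]
    have e1 : (1 + (t : ℂ) • (mpow A (1/2) * B * mpow A (1/2)))
        = 1 + ((t : ℂ) • (mpow A (1/2) * B)) * mpow A (1/2) := by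
      rw [Matrix.smul_mul]
    have e2 : mpow A (1/2) * ((t : ℂ) • (mpow A (1/2) * B)) = U * (diagonal (fun i => (a i : ℂ)) * (W * diagonal (fun i => ((t * b i : ℝ) : ℂ)) * Vᴴ)) := by
      rw [Matrix.mul_smul, ← Matrix.mul_assoc, hsq 1 one_pos, hA1, hd, hWdef, Matrix.mul_smul,
        Matrix.smul_mul, Matrix.mul_smul, Matrix.mul_smul]
      conv_lhs => rw [hAU, hBV]
      simp only [Matrix.mul_assoc]
    rw [e1, det_one_add_mul_comm, e2, det_one_add_mul_comm, hWH]
    simp only [Matrix.mul_assoc]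
  have key := det_log_nonneg W hW a (fun j => t * b j) ha (fun j => mul_nonneg ht.le (hb j))
  rw [← hdet2, hdet1, Complex.ofReal_re,
    ← Real.le_log_iff_exp_le (Finset.prod_pos fun k _ => hpos k),
    Real.log_prod (fun k _ => (hpos k).ne')] at key
  rw [Fintype.sum_prod_type]
  refine le_trans (le_of_eq ?_) key
  refine Finset.sum_congr rfl fun i _ => Finset.sum_congr rfl fun j _ => ?_
  rw [mul_left_comm]
end

section
/- (BLP trace inequality.) Let A and B be n×n complex positive semidefinite matrices. Then for every s ∈ [0,1] and every real t ≥ 0: Tr[A^{t+s} · B^s] ≤ Tr[A^t · (A^{1/2} B A^{1/2})^s]. (Both traces are real; equivalently the inequality holds between their real parts.) -/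
open scoped ComplexOrder

open scoped Matrix

namespace BLP

lemma cfc_diag {n : ℕ} {M : Matrix (Fin n) (Fin n) ℂ} (hM : M.IsHermitian) (f : ℝ → ℝ) (i : Fin n) :
    (cfc f M i i).re =
      ∑ k, Complex.normSq ((hM.eigenvectorUnitary : Matrix (Fin n) (Fin n) ℂ) i k)
        * f (hM.eigenvalues k) := by
  rw [hM.cfc_eq, Matrix.IsHermitian.cfc, Unitary.conjStarAlgAut_apply]
  rw [Matrix.mul_apply, Complex.re_sum]
  refine Finset.sum_congr rfl fun k _ => ?_
  rw [Matrix.mul_diagonal, Matrix.star_apply]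
  simp [Complex.normSq_apply]
  ring

lemma cont {n : ℕ} (M : Matrix (Fin n) (Fin n) ℂ) (f : ℝ → ℝ) : ContinuousOn f (spectrum ℝ M) :=
  (Matrix.finite_real_spectrum (A := M)).continuousOn f

lemma cfc_psd {n : ℕ} {M : Matrix (Fin n) (Fin n) ℂ} (hM : M.PosSemidef) (f : ℝ → ℝ)
    (hf : ∀ x, 0 ≤ x → 0 ≤ f x) : (cfc f M).PosSemidef := by
  rw [hM.1.cfc_eq, Matrix.IsHermitian.cfc, Unitary.conjStarAlgAut_apply]
  refine Matrix.PosSemidef.mul_mul_conjTranspose_same ?_ _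
  refine Matrix.PosSemidef.diagonal fun k => ?_
  simpa using hf _ (hM.eigenvalues_nonneg k)

lemma resolvent {n : ℕ} {M : Matrix (Fin n) (Fin n) ℂ} (hM : M.PosSemidef) (u α : ℝ) (hu : 0 < u)
    (hα : 0 ≤ α) :
    ((u : ℂ) • (1 : Matrix (Fin n) (Fin n) ℂ) + (α : ℂ) • M) * cfc (fun x : ℝ => (u + α * x)⁻¹) M = 1 := by
  have hs : IsSelfAdjoint M := hM.1
  have h1 : (u : ℂ) • (1 : Matrix (Fin n) (Fin n) ℂ) + (α : ℂ) • M = cfc (fun x : ℝ => u + α * x) M := by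
    rw [cfc_const_add u (fun x => α * x) M (cont _ _), cfc_const_mul_id α M, Algebra.algebraMap_eq_smul_one]
    rfl
  rw [h1, ← cfc_mul _ _ M (cont _ _) (cont _ _), ← cfc_one ℝ M]
  refine cfc_congr fun x hx => ?_
  have hx0 : 0 ≤ x := by
    rw [hM.1.spectrum_real_eq_range_eigenvalues] at hx
    obtain ⟨k, rfl⟩ := hx
    exact hM.eigenvalues_nonneg k
  have : u + α * x ≠ 0 := by positivity
  simp [this]

/-- variational bound -/
lemma key_entry {n : ℕ} {B : Matrix (Fin n) (Fin n) ℂ} (hB : B.PosSemidef) (d : Fin n → ℝ)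
    (u : ℝ) (hu : 0 < u) (C R : Matrix (Fin n) (Fin n) ℂ)
    (hC : C = Matrix.diagonal (fun i => (d i : ℂ)) * B * Matrix.diagonal (fun i => (d i : ℂ)))
    (hRh : Rᴴ = R)
    (hR : ((u : ℂ) • (1 : Matrix (Fin n) (Fin n) ℂ) + C) * R = 1)
    (i : Fin n) (hd : 0 < d i) :
    (R i i).re + u * ∑ j, Complex.normSq (R i j) * (1 - d j ^ 2 / d i ^ 2)
      ≤ (cfc (fun x : ℝ => (u + (d i)^2 * x)⁻¹) B i i).re := by
  set G := cfc (fun x : ℝ => (u + (d i)^2 * x)⁻¹) B with hG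
  set D := Matrix.diagonal (fun i => (d i : ℂ)) with hD
  set T := (u : ℂ) • (1 : Matrix (Fin n) (Fin n) ℂ) + (((d i)^2 : ℝ) : ℂ) • B with hT
  have hTG : T * G = 1 := resolvent hB u _ hu (by positivity)
  have hGT : G * T = 1 := mul_eq_one_comm.mp hTG
  have hGp : G.PosSemidef := cfc_psd hB _ (fun x hx => by positivity)
  have hDh : Dᴴ = D := by
    rw [hD, Matrix.diagonal_conjTranspose]; congr 1; ext j; simp
  have hBh : Bᴴ = B := hB.1
  have hTh : Tᴴ = T := by
    rw [hT, Matrix.conjTranspose_add, Matrix.conjTranspose_smul, Matrix.conjTranspose_smul, hBh]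
    simp
  set X := ((d i : ℂ)⁻¹) • (D * R) with hX
  have hP := hGp.conjTranspose_mul_mul_same (1 - T * X)
  have hE : (1 - T * X)ᴴ * G * (1 - T * X) = G - X - Xᴴ + Xᴴ * T * X := by
    rw [Matrix.conjTranspose_sub, Matrix.conjTranspose_mul, Matrix.conjTranspose_one, hTh]
    have e1 : (Xᴴ * T) * G = Xᴴ := by rw [Matrix.mul_assoc, hTG, Matrix.mul_one]
    have e2 : G * (T * X) = X := by rw [← Matrix.mul_assoc, hGT, Matrix.one_mul]
    rw [Matrix.sub_mul, Matrix.one_mul, e1, Matrix.mul_sub, Matrix.mul_one, Matrix.sub_mul, e2,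
      ← Matrix.mul_assoc]
    abel
  have hdc : (d i : ℂ) ≠ 0 := by exact_mod_cast hd.ne'
  have hXTX : Xᴴ * T * X = (u * ((d i : ℂ)^2)⁻¹) • (R * (D * D) * R) + R - (u:ℂ) • (R * R) := by
    have hCR : C * R = 1 - (u : ℂ) • R := by
      rw [Matrix.add_mul, Matrix.smul_mul, Matrix.one_mul] at hR
      rw [← hR]; abel
    have : Xᴴ = ((d i : ℂ)⁻¹) • (R * D) := by
      rw [hX, Matrix.conjTranspose_smul, Matrix.conjTranspose_mul, hRh, hDh]; simp
    rw [this, hX, hT]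
    have e : R * (C * R) = R - (u:ℂ) • (R * R) := by
      rw [hCR]; simp [Matrix.mul_sub]
    rw [add_sub_assoc, ← e, hC]
    simp only [Matrix.smul_mul, Matrix.mul_smul, Matrix.mul_add, Matrix.add_mul, smul_smul,
      Matrix.mul_assoc, Matrix.mul_one, Matrix.one_mul, smul_add]
    congr 1
    · congr 1; field_simp
    · rw [show (d i : ℂ)⁻¹ * ((((d i)^2 : ℝ) : ℂ) * (d i : ℂ)⁻¹) = 1 by push_cast; field_simp, one_smul]
  have h0 := (Complex.le_def.mp (hP.diag_nonneg (i := i))).1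
  rw [hE, hXTX] at h0
  have hXii : X i i = R i i := by
    rw [hX, Matrix.smul_apply, hD, Matrix.diagonal_mul]; simp [hdc]
  have hXii' : Xᴴ i i = star (R i i) := by rw [Matrix.conjTranspose_apply, hXii]
  have hRs : ∀ j, R j i = star (R i j) := fun j => by
    rw [← Matrix.conjTranspose_apply, hRh]
  have hRR : ((R * R) i i) = ((∑ j, Complex.normSq (R i j) : ℝ) : ℂ) := by
    rw [Matrix.mul_apply]; push_cast
    refine Finset.sum_congr rfl fun j _ => ?_
    rw [hRs j]; exact Complex.mul_conj _
  have hRDR : ((R * (D * D) * R) i i) = ((∑ j, Complex.normSq (R i j) * d j ^ 2 : ℝ) : ℂ) := by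
    rw [hD, Matrix.diagonal_mul_diagonal, Matrix.mul_apply]; push_cast
    refine Finset.sum_congr rfl fun j _ => ?_
    rw [Matrix.mul_diagonal, hRs j, ← Complex.mul_conj]
    simp only [Complex.star_def]; ring
  simp only [Matrix.add_apply, Matrix.sub_apply, Matrix.smul_apply, hXii, hXii', hRR, hRDR, smul_eq_mul] at h0
  have e3 : (u * ((d i : ℂ)^2)⁻¹) * ((∑ j, Complex.normSq (R i j) * d j ^ 2 : ℝ) : ℂ)
     = ((u * ((d i)^2)⁻¹ * (∑ j, Complex.normSq (R i j) * d j ^ 2) : ℝ) : ℂ) := by push_cast; ring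
  rw [e3, ← Complex.ofReal_mul] at h0
  simp only [Complex.add_re, Complex.sub_re, Complex.ofReal_re, Complex.star_def, Complex.conj_re, Complex.zero_re] at h0
  have e4 : u * ∑ j, Complex.normSq (R i j) * (1 - d j ^ 2 / d i ^ 2)
     = u * (∑ j, Complex.normSq (R i j)) - u * ((d i)^2)⁻¹ * (∑ j, Complex.normSq (R i j) * d j ^ 2) := by
    simp only [mul_sub, Finset.sum_sub_distrib, mul_one]
    rw [mul_assoc, Finset.mul_sum (a := ((d i)^2)⁻¹)]
    congr 2
    refine Finset.sum_congr rfl fun j _ => ?_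
    rw [div_eq_mul_inv]; ring
  rw [e4]; linarith

lemma sym_sum {n : ℕ} (w : Fin n → Fin n → ℝ) (hw : ∀ i j, 0 ≤ w i j) (hws : ∀ i j, w i j = w j i)
    (q r : Fin n → ℝ) (hqr : ∀ i j, 0 ≤ (q i - q j) * (r i - r j)) :
    0 ≤ ∑ i, ∑ j, w i j * (q i * r i - q i * r j) := by
  have h1 : ∑ i, ∑ j, w i j * (q i * r i - q i * r j) = ∑ i, ∑ j, w i j * (q j * r j - q j * r i) := by
    rw [Finset.sum_comm]
    refine Finset.sum_congr rfl fun i _ => Finset.sum_congr rfl fun j _ => ?_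
    rw [hws]
  have h2 : 0 ≤ ∑ i, ∑ j, w i j * ((q i - q j) * (r i - r j)) :=
    Finset.sum_nonneg fun i _ => Finset.sum_nonneg fun j _ => mul_nonneg (hw i j) (hqr i j)
  have h3 : ∑ i, ∑ j, w i j * ((q i - q j) * (r i - r j)) =
     ∑ i, ∑ j, w i j * (q i * r i - q i * r j) + ∑ i, ∑ j, w i j * (q j * r j - q j * r i) := by
    rw [← Finset.sum_add_distrib]
    refine Finset.sum_congr rfl fun i _ => ?_
    rw [← Finset.sum_add_distrib]
    refine Finset.sum_congr rfl fun j _ => ?_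
    ring
  linarith

lemma diag_psd {n : ℕ} {B : Matrix (Fin n) (Fin n) ℂ} (hB : B.PosSemidef) (d : Fin n → ℝ) :
    (Matrix.diagonal (fun i => (d i : ℂ)) * B * Matrix.diagonal (fun i => (d i : ℂ))).PosSemidef := by
  have := hB.mul_mul_conjTranspose_same (Matrix.diagonal (fun i => (d i : ℂ)))
  rwa [Matrix.diagonal_conjTranspose, show star (fun i => (d i : ℂ)) = fun i => (d i : ℂ) by ext; simp] at this

/-- pointwise resolvent inequality -/
lemma pointwise {n : ℕ} {B : Matrix (Fin n) (Fin n) ℂ} (hB : B.PosSemidef) (a : Fin n → ℝ)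
    (ha : ∀ i, 0 ≤ a i) (δ τ : ℝ) (hδ : 0 < δ) (hτ : δ < τ) (u : ℝ) (hu : 0 < u) :
    ∑ i, a i ^ τ * (cfc (fun x : ℝ => (u + 1 * x)⁻¹) (Matrix.diagonal (fun i => ((a i ^ (δ/2) : ℝ) : ℂ)) * B *
       Matrix.diagonal (fun i => ((a i ^ (δ/2) : ℝ) : ℂ))) i i).re
     ≤ ∑ i, a i ^ τ * (cfc (fun x : ℝ => (u + a i ^ δ * x)⁻¹) B i i).re := by
  have hCp := diag_psd hB (fun i => a i ^ (δ/2))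
  set C := Matrix.diagonal (fun i => ((a i ^ (δ/2) : ℝ) : ℂ)) * B *
       Matrix.diagonal (fun i => ((a i ^ (δ/2) : ℝ) : ℂ)) with hC
  set R := cfc (fun x : ℝ => (u + 1 * x)⁻¹) C with hR
  have hRp : R.PosSemidef := cfc_psd hCp _ (fun x hx => by positivity)
  have hRR := resolvent hCp u 1 hu zero_le_one
  rw [← hR, Complex.ofReal_one, one_smul] at hRR
  have hsq : ∀ i, (a i ^ (δ/2))^2 = a i ^ δ := fun i => by
    rw [← Real.rpow_natCast, ← Real.rpow_mul (ha i)]; norm_num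
  have hRs : ∀ i j, Complex.normSq (R i j) = Complex.normSq (R j i) := fun i j => by
    have : R j i = star (R i j) := by rw [← Matrix.conjTranspose_apply, hRp.1]
    rw [this]; simp
  have h0 := sym_sum (fun i j => Complex.normSq (R i j)) (fun _ _ => Complex.normSq_nonneg _) hRs
    (fun i => a i ^ (τ - δ)) (fun i => a i ^ δ) (fun i j => by
      rcases le_total (a i) (a j) with h | h
      · refine mul_nonneg_of_nonpos_of_nonpos ?_ ?_ <;> rw [sub_nonpos]
        · exact Real.rpow_le_rpow (ha i) h (by linarith)
        · exact Real.rpow_le_rpow (ha i) h (by linarith)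
      · refine mul_nonneg ?_ ?_ <;> rw [sub_nonneg]
        · exact Real.rpow_le_rpow (ha j) h (by linarith)
        · exact Real.rpow_le_rpow (ha j) h (by linarith))
  have h1 : ∀ i, a i ^ τ * (R i i).re + u * ∑ j, Complex.normSq (R i j) *
      (a i ^ (τ - δ) * a i ^ δ - a i ^ (τ - δ) * a j ^ δ) ≤
      a i ^ τ * (cfc (fun x : ℝ => (u + a i ^ δ * x)⁻¹) B i i).re := by
    intro i
    rcases (ha i).eq_or_lt with h | h
    · rw [← h, Real.zero_rpow (by linarith), Real.zero_rpow (by linarith)]; simp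
    · have hk := key_entry hB (fun i => a i ^ (δ/2)) u hu C R hC hRp.1 hRR i (by positivity)
      simp only [hsq] at hk
      have := mul_le_mul_of_nonneg_left hk (Real.rpow_nonneg (ha i) τ)
      refine le_trans (le_of_eq ?_) this
      rw [mul_add]; congr 1
      rw [mul_left_comm]; congr 1
      rw [Finset.mul_sum]
      refine Finset.sum_congr rfl fun j _ => ?_
      have e : a i ^ τ = a i ^ (τ - δ) * a i ^ δ := by rw [← Real.rpow_add h]; simp
      have : a i ^ δ ≠ 0 := by positivity
      rw [e]; field_simp
  have h2 := Finset.sum_le_sum (fun i (_ : i ∈ Finset.univ) => h1 i)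
  rw [Finset.sum_add_distrib, ← Finset.mul_sum] at h2
  have := mul_nonneg hu.le h0
  linarith

open MeasureTheory in
lemma step {n : ℕ} {B : Matrix (Fin n) (Fin n) ℂ} (hB : B.PosSemidef) (a : Fin n → ℝ)
    (ha : ∀ i, 0 ≤ a i) (δ τ s : ℝ) (hδ : 0 < δ) (hτ : δ < τ) (hs : s ∈ Set.Ioo (0:ℝ) 1) :
    ∑ i, a i ^ (τ + δ * s) * (mpow B s i i).re ≤
    ∑ i, a i ^ τ * (mpow (Matrix.diagonal (fun i => ((a i ^ (δ/2) : ℝ) : ℂ)) * B *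
       Matrix.diagonal (fun i => ((a i ^ (δ/2) : ℝ) : ℂ))) s i i).re := by
  obtain ⟨μ, hμ⟩ := Real.exists_measure_rpow_eq_integral_rpowIntegrand₀₁ hs
  have rep : ∀ {M : Matrix (Fin n) (Fin n) ℂ} (hM : M.PosSemidef) (α : ℝ) (hα : 0 ≤ α) (i : Fin n),
      IntegrableOn (fun u => (cfc (fun x : ℝ => Real.rpowIntegrand₀₁ s u (α * x)) M i i).re) (Set.Ioi 0) μ ∧
      α ^ s * (mpow M s i i).re =
        ∫ u in Set.Ioi 0, (cfc (fun x : ℝ => Real.rpowIntegrand₀₁ s u (α * x)) M i i).re ∂μ := by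
    intro M hM α hα i
    have hI : ∀ k, IntegrableOn (fun u => Complex.normSq ((hM.1.eigenvectorUnitary : Matrix (Fin n) (Fin n) ℂ) i k)
        * Real.rpowIntegrand₀₁ s u (α * hM.1.eigenvalues k)) (Set.Ioi 0) μ := fun k =>
      (hμ _ (mul_nonneg hα (hM.eigenvalues_nonneg k))).1.const_mul _
    simp only [cfc_diag hM.1, mpow]
    refine ⟨integrable_finsetSum _ fun k _ => hI k, ?_⟩
    rw [integral_finsetSum _ fun k _ => hI k, Finset.mul_sum]
    refine Finset.sum_congr rfl fun k _ => ?_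
    rw [integral_const_mul, ← (hμ _ (mul_nonneg hα (hM.eigenvalues_nonneg k))).2,
      Real.mul_rpow hα (hM.eigenvalues_nonneg k)]
    ring
  have hCp := diag_psd hB (fun i => a i ^ (δ/2))
  have hL : ∑ i, a i ^ (τ + δ * s) * (mpow B s i i).re = ∫ u in Set.Ioi 0,
      ∑ i, a i ^ τ * (cfc (fun x : ℝ => Real.rpowIntegrand₀₁ s u (a i ^ δ * x)) B i i).re ∂μ := by
    rw [integral_finsetSum _ fun i _ => (rep hB _ (Real.rpow_nonneg (ha i) δ) i).1.const_mul _]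
    refine Finset.sum_congr rfl fun i _ => ?_
    rw [integral_const_mul, ← (rep hB _ (Real.rpow_nonneg (ha i) δ) i).2,
      Real.rpow_add_of_nonneg (ha i) (by linarith) (mul_nonneg hδ.le hs.1.le), Real.rpow_mul (ha i)]
    ring
  have hRr : ∑ i, a i ^ τ * (mpow (Matrix.diagonal (fun i => ((a i ^ (δ/2) : ℝ) : ℂ)) * B *
       Matrix.diagonal (fun i => ((a i ^ (δ/2) : ℝ) : ℂ))) s i i).re = ∫ u in Set.Ioi 0,
      ∑ i, a i ^ τ * (cfc (fun x : ℝ => Real.rpowIntegrand₀₁ s u (1 * x))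
        (Matrix.diagonal (fun i => ((a i ^ (δ/2) : ℝ) : ℂ)) * B *
       Matrix.diagonal (fun i => ((a i ^ (δ/2) : ℝ) : ℂ))) i i).re ∂μ := by
    rw [integral_finsetSum _ fun i _ => (rep hCp 1 zero_le_one i).1.const_mul _]
    refine Finset.sum_congr rfl fun i _ => ?_
    rw [integral_const_mul, ← (rep hCp 1 zero_le_one i).2, Real.one_rpow, one_mul]
  rw [hL, hRr]
  refine setIntegral_mono_on (integrable_finsetSum _ fun i _ => (rep hB _ (Real.rpow_nonneg (ha i) δ) i).1.const_mul _)
    (integrable_finsetSum _ fun i _ => (rep hCp 1 zero_le_one i).1.const_mul _) measurableSet_Ioi ?_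
  intro u hu
  have hu : 0 < u := hu
  have conv : ∀ {M : Matrix (Fin n) (Fin n) ℂ} (hM : M.PosSemidef) (α : ℝ) (i : Fin n),
      (cfc (fun x : ℝ => Real.rpowIntegrand₀₁ s u (α * x)) M i i).re =
        u ^ s * (u⁻¹ - (cfc (fun x : ℝ => (u + α * x)⁻¹) M i i).re) := by
    intro M hM α i
    have hsa : IsSelfAdjoint M := hM.1
    unfold Real.rpowIntegrand₀₁
    rw [cfc_const_mul _ _ M (cont _ _), cfc_sub _ _ M (cont _ _) (cont _ _), cfc_const _ M,
      Algebra.algebraMap_eq_smul_one]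
    simp
  have hp := pointwise hB a ha δ τ hδ hτ u hu
  have hus : 0 ≤ u ^ s := Real.rpow_nonneg hu.le s
  simp only [conv hB, conv hCp]
  have e : ∀ x : Fin n → ℝ, ∑ i, a i ^ τ * (u ^ s * (u⁻¹ - x i)) =
      u ^ s * (∑ i, a i ^ τ * u⁻¹ - ∑ i, a i ^ τ * x i) := by
    intro x
    rw [← Finset.sum_sub_distrib, Finset.mul_sum]
    exact Finset.sum_congr rfl fun i _ => by ring
  rw [e, e]
  exact mul_le_mul_of_nonneg_left (by linarith) hus

lemma diag_pos {n : ℕ} {B : Matrix (Fin n) (Fin n) ℂ} (hB : B.PosSemidef) (a : Fin n → ℝ)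
    (ha : ∀ i, 0 ≤ a i) (t s : ℝ) (ht : 0 < t) (hs : s ∈ Set.Ioo (0:ℝ) 1) :
    ∑ i, a i ^ (t + s) * (mpow B s i i).re ≤
    ∑ i, a i ^ t * (mpow (Matrix.diagonal (fun i => ((a i ^ (1/2 : ℝ) : ℝ) : ℂ)) * B *
       Matrix.diagonal (fun i => ((a i ^ (1/2 : ℝ) : ℝ) : ℂ))) s i i).re := by
  obtain ⟨m, hm⟩ := exists_nat_one_div_lt ht
  set δ : ℝ := 1 / ((m : ℝ) + 1) with hδ
  have hδ0 : 0 < δ := by positivity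
  have hs0 := hs.1
  have hN : ∀ k : ℕ, k ≤ m + 1 → ∑ i, a i ^ (t + s) * (mpow B s i i).re ≤
    ∑ i, a i ^ (t + (1 - k * δ) * s) * (mpow (Matrix.diagonal (fun i => ((a i ^ (k * δ / 2 : ℝ) : ℝ) : ℂ)) * B *
       Matrix.diagonal (fun i => ((a i ^ (k * δ / 2 : ℝ) : ℝ) : ℂ))) s i i).re := by
    intro k
    induction k with
    | zero => intro _; simp
    | succ k ih =>
      intro hk
      refine (ih (by omega)).trans ?_
      have hk' : ((k : ℝ) + 1) * δ ≤ 1 := by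
        have : (k : ℝ) + 1 ≤ m + 1 := by exact_mod_cast hk
        rw [hδ, mul_one_div, div_le_one (by positivity)]; exact this
      have := step (diag_psd hB (fun i => a i ^ (k * δ / 2 : ℝ))) a ha δ (t + (1 - (k + 1) * δ) * s) s hδ0
        (by nlinarith) hs
      have e : Matrix.diagonal (fun i => ((a i ^ (((k + 1 : ℕ) : ℝ) * δ / 2 : ℝ) : ℝ) : ℂ)) =
        Matrix.diagonal (fun i => ((a i ^ (δ / 2 : ℝ) : ℝ) : ℂ)) * Matrix.diagonal (fun i => ((a i ^ (k * δ / 2 : ℝ) : ℝ) : ℂ)) := by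
        rw [Matrix.diagonal_mul_diagonal]; congr 1; ext j
        rw [← Complex.ofReal_mul, ← Real.rpow_add_of_nonneg (ha j) (by positivity) (by positivity)]
        congr 2; push_cast; ring
      have e' : Matrix.diagonal (fun i => ((a i ^ (δ / 2 : ℝ) : ℝ) : ℂ)) * Matrix.diagonal (fun i => ((a i ^ (k * δ / 2 : ℝ) : ℝ) : ℂ))
        = Matrix.diagonal (fun i => ((a i ^ (k * δ / 2 : ℝ) : ℝ) : ℂ)) * Matrix.diagonal (fun i => ((a i ^ (δ / 2 : ℝ) : ℝ) : ℂ)) := by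
        rw [Matrix.diagonal_mul_diagonal, Matrix.diagonal_mul_diagonal]; congr 1; ext j; ring
      have e3 : Matrix.diagonal (fun i => ((a i ^ (((k + 1 : ℕ) : ℝ) * δ / 2 : ℝ) : ℝ) : ℂ)) * B *
          Matrix.diagonal (fun i => ((a i ^ (((k + 1 : ℕ) : ℝ) * δ / 2 : ℝ) : ℝ) : ℂ)) =
          Matrix.diagonal (fun i => ((a i ^ (δ / 2 : ℝ) : ℝ) : ℂ)) *
          (Matrix.diagonal (fun i => ((a i ^ (k * δ / 2 : ℝ) : ℝ) : ℂ)) * B *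
          Matrix.diagonal (fun i => ((a i ^ (k * δ / 2 : ℝ) : ℝ) : ℂ))) *
          Matrix.diagonal (fun i => ((a i ^ (δ / 2 : ℝ) : ℝ) : ℂ)) := by
        rw [e]
        nth_rewrite 2 [e']
        simp only [Matrix.mul_assoc]
      rw [e3]
      rw [show t + (1 - (k + 1) * δ) * s + δ * s = t + (1 - k * δ) * s by ring] at this
      push_cast
      exact this
  have h := hN (m + 1) le_rfl
  have e : ((m + 1 : ℕ) : ℝ) * δ = 1 := by push_cast; rw [hδ]; field_simp
  rw [e] at h
  simpa using h

open Filter Topology in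
lemma diag_nonneg {n : ℕ} {B : Matrix (Fin n) (Fin n) ℂ} (hB : B.PosSemidef) (a : Fin n → ℝ)
    (ha : ∀ i, 0 ≤ a i) (t s : ℝ) (ht : 0 ≤ t) (hs : s ∈ Set.Icc (0:ℝ) 1) :
    ∑ i, a i ^ (t + s) * (mpow B s i i).re ≤
    ∑ i, a i ^ t * (mpow (Matrix.diagonal (fun i => ((a i ^ (1/2 : ℝ) : ℝ) : ℂ)) * B *
       Matrix.diagonal (fun i => ((a i ^ (1/2 : ℝ) : ℝ) : ℂ))) s i i).re := by
  have hCp := diag_psd hB (fun i => a i ^ (1/2 : ℝ))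
  set C := Matrix.diagonal (fun i => ((a i ^ (1/2 : ℝ) : ℝ) : ℂ)) * B *
       Matrix.diagonal (fun i => ((a i ^ (1/2 : ℝ) : ℝ) : ℂ)) with hC
  have hBs : IsSelfAdjoint B := hB.1
  have hCs : IsSelfAdjoint C := hCp.1
  rcases hs.1.eq_or_lt with h0 | h0
  · subst h0
    simp only [mpow, Real.rpow_zero, add_zero]
    rw [cfc_const_one ℝ B, cfc_const_one ℝ C]
  rcases hs.2.eq_or_lt with h1 | h1
  · subst h1
    simp only [mpow, Real.rpow_one]
    rw [cfc_id' ℝ B, cfc_id' ℝ C]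
    refine le_of_eq (Finset.sum_congr rfl fun i _ => ?_)
    rw [hC, Matrix.mul_diagonal, Matrix.diagonal_mul, Real.rpow_add_of_nonneg (ha i) ht zero_le_one, mul_assoc]
    congr 1
    rw [mul_right_comm, ← Complex.ofReal_mul, ← Real.rpow_add_of_nonneg (ha i) (by norm_num) (by norm_num),
      Complex.re_ofReal_mul]
    norm_num
  rcases ht.eq_or_lt with h2 | h2
  · subst h2
    have hl : Tendsto (fun r : ℝ => ∑ i, a i ^ (r + s) * (mpow B s i i).re) (𝓝[>] 0)
        (𝓝 (∑ i, a i ^ (0 + s) * (mpow B s i i).re)) := by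
      refine tendsto_finsetSum _ fun i _ => Tendsto.mul_const _ ?_
      have : ContinuousAt (fun r : ℝ => a i ^ (r + s)) 0 := by
        refine ContinuousAt.rpow continuousAt_const (by fun_prop) (Or.inr (by simpa using h0))
      exact this.tendsto.mono_left nhdsWithin_le_nhds
    have hr : ∀ i, 0 ≤ (mpow C s i i).re := fun i =>
      (Complex.le_def.mp ((cfc_psd hCp _ (fun x hx => Real.rpow_nonneg hx s)).diag_nonneg (i := i))).1
    have hr2 : Tendsto (fun r : ℝ => ∑ i, (if a i = 0 then 0 else a i ^ r) * (mpow C s i i).re) (𝓝[>] 0)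
        (𝓝 (∑ i, (if a i = 0 then 0 else a i ^ (0:ℝ)) * (mpow C s i i).re)) := by
      refine tendsto_finsetSum _ fun i _ => Tendsto.mul_const _ ?_
      split_ifs with h
      · exact tendsto_const_nhds
      · have : ContinuousAt (fun r : ℝ => a i ^ r) 0 := 
          ContinuousAt.rpow continuousAt_const continuousAt_id (Or.inl h)
        exact this.tendsto.mono_left nhdsWithin_le_nhds
    have hfin : ∑ i, a i ^ (0 + s) * (mpow B s i i).re ≤ ∑ i, (if a i = 0 then 0 else a i ^ (0:ℝ)) * (mpow C s i i).re := by
      refine le_of_tendsto_of_tendsto hl hr2 ?_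
      filter_upwards [self_mem_nhdsWithin] with r hr
      refine (diag_pos hB a ha r s hr ⟨h0, h1⟩).trans (le_of_eq (Finset.sum_congr rfl fun i _ => ?_))
      congr 1
      split_ifs with h
      · rw [h, Real.zero_rpow (ne_of_gt hr)]
      · rfl
    exact hfin.trans (Finset.sum_le_sum (fun i (_ : i ∈ Finset.univ) =>
      mul_le_mul_of_nonneg_right (show (if a i = 0 then 0 else a i ^ (0:ℝ)) ≤ a i ^ (0:ℝ) by split_ifs <;> simp) (hr i)))
  · exact diag_pos hB a ha t s h2 ⟨h0, h1⟩

lemma mpow_conj {n : ℕ} (U : Matrix.unitaryGroup (Fin n) ℂ) {M : Matrix (Fin n) (Fin n) ℂ}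
    (hM : M.IsHermitian) (s : ℝ) :
    mpow (Unitary.conjStarAlgAut ℂ _ U M) s = Unitary.conjStarAlgAut ℂ _ U (mpow M s) := by
  unfold mpow
  have hs : IsSelfAdjoint M := hM
  symm
  refine StarAlgHomClass.map_cfc (S := ℂ) (Unitary.conjStarAlgAut ℂ _ U) _ M (cont _ _) ?_ hs (hs.map _)
  change Continuous fun x : Matrix (Fin n) (Fin n) ℂ => (U : Matrix (Fin n) (Fin n) ℂ) * x * (star U : Matrix (Fin n) (Fin n) ℂ)
  fun_prop

end BLP

/-- BLP trace inequality: for `A, B` positive semidefinite, `s ∈ [0,1]` and `t ≥ 0`: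
`Tr[A^{t+s} B^s] ≤ Tr[A^t (A^{1/2} B A^{1/2})^s]` (as real parts of the traces). -/
theorem stmt_11 {n : ℕ} (A B : Matrix (Fin n) (Fin n) ℂ)
    (hA : A.PosSemidef) (hB : B.PosSemidef)
    (s t : ℝ) (hs : s ∈ Set.Icc (0 : ℝ) 1) (ht : 0 ≤ t) :
    (Matrix.trace (mpow A (t + s) * mpow B s)).re ≤
      (Matrix.trace (mpow A t * mpow (mpow A (1/2) * B * mpow A (1/2)) s)).re := by
  set a := hA.1.eigenvalues with ha
  set φ := Unitary.conjStarAlgAut ℂ (Matrix (Fin n) (Fin n) ℂ) hA.1.eigenvectorUnitary with hφ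
  have hAp : ∀ r : ℝ, mpow A r = φ (Matrix.diagonal (fun i => ((a i ^ r : ℝ) : ℂ))) := fun r => by
    rw [mpow, hA.1.cfc_eq]; rfl
  obtain ⟨B', hB'⟩ : ∃ B', φ B' = B := φ.surjective B
  have hB'p : B'.PosSemidef := by
    have : B' = (star hA.1.eigenvectorUnitary : Matrix (Fin n) (Fin n) ℂ) * B * (hA.1.eigenvectorUnitary : Matrix (Fin n) (Fin n) ℂ) := by
      rw [← Unitary.conjStarAlgAut_symm_apply (S := ℂ), ← hφ, ← hB']; simp
    rw [this]
    exact hB.conjTranspose_mul_mul_same _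
  have htr : ∀ M, Matrix.trace (φ M) = Matrix.trace M := fun M => by
    rw [hφ, Unitary.conjStarAlgAut_apply, Matrix.trace_mul_comm, ← Matrix.mul_assoc]
    simp
  have hdt : ∀ (d : Fin n → ℝ) (M : Matrix (Fin n) (Fin n) ℂ),
      (Matrix.trace (Matrix.diagonal (fun i => (d i : ℂ)) * M)).re = ∑ i, d i * (M i i).re := fun d M => by
    simp [Matrix.trace, Matrix.diagonal_mul]
  have hmain := BLP.diag_nonneg hB'p a hA.eigenvalues_nonneg t s ht hs
  rw [hAp, hAp, hAp, ← hB', ← map_mul, ← map_mul, BLP.mpow_conj _ hB'p.1,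
    BLP.mpow_conj _ (BLP.diag_psd hB'p _).1, ← hφ, ← map_mul, ← map_mul, htr, htr, hdt, hdt]
  exact hmain
end
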